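/- arXiv:1310.1198 — 5 statements merged into one kernel-verified Lean document; each statement's English description precedes it below -/
import Mathlib

section
/- Let (Y, 𝒟, ν, G) be an MDS, let 𝐃 = {d_F : F ∈ 𝓕_G} ⊆ L¹(Y, 𝒟, ν) be a strongly sub-additive G-invariant family, and let {F_n : n ∈ ℕ} be a tempered Følner sequence of G. Then for ν-a.e. y ∈ Y, limsup_{n→∞} d_{F_n}(y)/|F_n| = inf_{F ∈ 𝓕_G} (1/|F|) E(d_F | 𝓘)(y); this function is G-invariant and measurable, and ∫_Y inf_{F ∈ 𝓕_G} (1/|F|) E(d_F | 𝓘)(y) dν(y) = ν(𝐃). -/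
open MeasureTheory Filter Topology
open scoped symmDiff Pointwise ENNReal

/-- `F` is a Følner sequence of `G`. -/
def IsFolner {G : Type*} [Group G] [DecidableEq G] (F : ℕ → Finset G) : Prop :=
  (∀ n, (F n).Nonempty) ∧
    ∀ g : G, Tendsto (fun n => ((((F n).image (g * ·)) ∆ (F n)).card : ℝ) / ((F n).card : ℝ))
      atTop (𝓝 0)

/-- `F` is tempered: `|⋃_{k ≤ n} F_k⁻¹ F_{n+1}| ≤ M |F_{n+1}|` for some `M > 0`. -/
def IsTempered {G : Type*} [Group G] [DecidableEq G] (F : ℕ → Finset G) : Prop :=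
  ∃ M : ℝ, 0 < M ∧ ∀ n : ℕ,
    ((((Finset.range (n + 1)).biUnion fun k => (F k)⁻¹ * F (n + 1)).card : ℝ))
      ≤ M * ((F (n + 1)).card : ℝ)

/-- The σ-algebra `𝓘` of `G`-invariant sets. -/
def invSigma (G : Type*) {Y : Type*} [Group G] [MulAction G Y] [MeasurableSpace Y]
    (ν : Measure Y) : MeasurableSpace Y :=
  MeasurableSpace.generateFrom {D : Set Y | MeasurableSet D ∧ ∀ g : G, ν ((g • D) ∆ D) = 0}

/-- The positive part of an extended real, as an extended non-negative real. -/
noncomputable def erealPosPart (x : EReal) : ℝ≥0∞ :=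
  if x = ⊤ then ⊤ else ENNReal.ofReal x.toReal

/-- Integral of an `EReal`-valued function, with values in `EReal`. -/
noncomputable def erealIntegral {Y : Type*} [MeasurableSpace Y] (ν : Measure Y)
    (f : Y → EReal) : EReal :=
  ((∫⁻ y, erealPosPart (f y) ∂ν : ℝ≥0∞) : EReal)
    - ((∫⁻ y, erealPosPart (-(f y)) ∂ν : ℝ≥0∞) : EReal)

section Covering

variable {G : Type*} [Group G] [DecidableEq G]

/-- Greedy selection of translates of a single finite set `F` carrying a large part of the mass
of `φ`. -/
theorem exists_subset_translates_mass (F : Finset G) (hF : F.Nonempty) (A : Finset G) (φ : G → ℝ)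
    (hφ : ∀ x, 0 ≤ φ x) (l : ℝ)
    (h : ∀ a ∈ A, l * (F.card : ℝ) ≤ ∑ x ∈ F.image (· * a), φ x) :
    ∃ S ⊆ A, l * (A.card : ℝ) ≤ 2 * ∑ x ∈ S.biUnion (fun a => F.image (· * a)), φ x ∧
      l * (S.card * F.card : ℝ) ≤ 2 * ∑ x ∈ S.biUnion (fun a => F.image (· * a)), φ x := by
  classical
  let B : Finset G → Finset G := fun S => S.biUnion (fun a => F.image (· * a))
  let P : Finset (Finset G) :=
    A.powerset.filter fun S => l * (S.card * F.card : ℝ) ≤ 2 * ∑ x ∈ B S, φ x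
  have hP : P.Nonempty := ⟨∅, by simp [P, B]⟩
  obtain ⟨S, hS, hmax⟩ := Finset.exists_max_image P Finset.card hP
  simp only [P, Finset.mem_filter, Finset.mem_powerset] at hS
  refine ⟨S, hS.1, ?_, hS.2⟩
  have hFpos : (0 : ℝ) < F.card := by exact_mod_cast hF.card_pos
  have key : ∀ a ∈ A, l * (F.card : ℝ) ≤ 2 * ∑ x ∈ F.image (· * a) ∩ B S, φ x := by
    intro a ha
    have h1 := h a ha
    by_cases haS : a ∈ S
    · have : F.image (· * a) ∩ B S = F.image (· * a) :=
        Finset.inter_eq_left.2 (Finset.subset_biUnion_of_mem (fun a => F.image (· * a)) haS)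
      rw [this]
      have := Finset.sum_nonneg (s := F.image (· * a)) (fun x _ => hφ x)
      linarith
    · have hsplit := Finset.sum_inter_add_sum_sdiff (F.image (· * a)) (B S) φ
      have hlt : 2 * ∑ x ∈ F.image (· * a) \ B S, φ x < l * F.card := by
        by_contra! hcon
        have hmem : insert a S ∈ P := by
          simp only [P, Finset.mem_filter, Finset.mem_powerset]
          refine ⟨Finset.insert_subset ha hS.1, ?_⟩
          have hB : B (insert a S) = (F.image (· * a) \ B S) ∪ B S := by
            simp [B, Finset.biUnion_insert]
          rw [hB, Finset.sum_union Finset.sdiff_disjoint, Finset.card_insert_of_notMem haS]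
          push_cast
          nlinarith [hS.2]
        have := hmax _ hmem
        rw [Finset.card_insert_of_notMem haS] at this
        omega
      linarith
  have hcount : ∑ a ∈ A, ∑ x ∈ F.image (· * a) ∩ B S, φ x ≤ F.card * ∑ x ∈ B S, φ x := by
    have : ∀ a ∈ A, ∑ x ∈ F.image (· * a) ∩ B S, φ x
        = ∑ x ∈ B S, if x ∈ F.image (· * a) then φ x else 0 := by
      intro a _
      rw [← Finset.sum_filter, Finset.inter_comm, Finset.filter_mem_eq_inter]
    rw [Finset.sum_congr rfl this, Finset.sum_comm, Finset.mul_sum]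
    refine Finset.sum_le_sum fun x _ => ?_
    rw [← Finset.sum_filter, Finset.sum_const, nsmul_eq_mul]
    refine mul_le_mul_of_nonneg_right ?_ (hφ x)
    have : A.filter (fun a => x ∈ F.image (· * a)) ⊆ F.image (fun f => f⁻¹ * x) := by
      intro a ha
      simp only [Finset.mem_filter, Finset.mem_image] at ha ⊢
      obtain ⟨_, f, hf, rfl⟩ := ha
      exact ⟨f, hf, by group⟩
    exact_mod_cast (Finset.card_le_card this).trans Finset.card_image_le
  have hsum : (A.card : ℝ) * (l * F.card) ≤ 2 * (F.card * ∑ x ∈ B S, φ x) := by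
    calc (A.card : ℝ) * (l * F.card) = ∑ a ∈ A, l * (F.card : ℝ) := by
          rw [Finset.sum_const, nsmul_eq_mul]
      _ ≤ ∑ a ∈ A, 2 * ∑ x ∈ F.image (· * a) ∩ B S, φ x := Finset.sum_le_sum key
      _ ≤ _ := by rw [← Finset.mul_sum]; linarith
  refine le_of_mul_le_mul_left ?_ hFpos
  change (F.card : ℝ) * (l * A.card) ≤ F.card * (2 * ∑ x ∈ B S, φ x)
  linarith

/-- The combinatorial maximal inequality for a tempered sequence of finite sets. -/
theorem IsTempered.card_le_of_forall_le_sum {F : ℕ → Finset G} (hne : ∀ n, (F n).Nonempty) {M : ℝ}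
    (hM : 0 < M)
    (htemp : ∀ n : ℕ, ((((Finset.range (n + 1)).biUnion fun k => (F k)⁻¹ * F (n + 1)).card : ℝ))
      ≤ M * ((F (n + 1)).card : ℝ))
    (φ : G → ℝ) (hφ : ∀ x, 0 ≤ φ x) {l : ℝ} (hl : 0 ≤ l) (N : ℕ) :
    ∀ (A K : Finset G) (i : G → ℕ), (∀ a ∈ A, i a < N) →
      (∀ a ∈ A, (F (i a)).image (· * a) ⊆ K) →
      (∀ a ∈ A, l * ((F (i a)).card : ℝ) ≤ ∑ x ∈ (F (i a)).image (· * a), φ x) →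
      l * (A.card : ℝ) ≤ 2 * (1 + M) * ∑ x ∈ K, φ x := by
  induction N with
  | zero =>
    intro A K i hi _ _
    have : A = ∅ := Finset.eq_empty_of_forall_notMem fun a ha => absurd (hi a ha) (by omega)
    subst this
    have := Finset.sum_nonneg (s := K) (fun x _ => hφ x)
    simp only [Finset.card_empty, Nat.cast_zero, mul_zero]
    positivity
  | succ N ih =>
    intro A K i hi hK h
    obtain ⟨S, hSA, hS1, hS2⟩ := exists_subset_translates_mass (F N) (hne N)
      (A.filter fun a => i a = N) φ hφ l (by
        intro a ha
        rw [Finset.mem_filter] at ha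
        have := h a ha.1
        rwa [ha.2] at this)
    set B := S.biUnion (fun a => (F N).image (· * a)) with hB
    have hBK : B ⊆ K := by
      refine Finset.biUnion_subset.2 fun a ha => ?_
      have h2 := Finset.mem_filter.1 (hSA ha)
      have := hK a h2.1
      rwa [h2.2] at this
    have hrec := ih (A.filter fun a => i a ≠ N ∧ Disjoint ((F (i a)).image (· * a)) B)
      (K \ B) i
      (by
        intro a ha
        rw [Finset.mem_filter] at ha
        have := hi a ha.1
        have := ha.2.1
        omega)
      (by
        intro a ha
        rw [Finset.mem_filter] at ha
        exact Finset.subset_sdiff.2 ⟨hK a ha.1, ha.2.2⟩)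
      (by
        intro a ha
        rw [Finset.mem_filter] at ha
        exact h a ha.1)
    have hrem : ((A.filter fun a => i a ≠ N ∧ ¬ Disjoint ((F (i a)).image (· * a)) B).card : ℝ)
        ≤ M * (S.card * (F N).card) := by
      rcases N with _ | m
      · have : (A.filter fun a => i a ≠ 0 ∧ ¬ Disjoint ((F (i a)).image (· * a)) B) = ∅ := by
          refine Finset.filter_eq_empty_iff.2 fun a ha hcon => ?_
          have := hi a ha
          omega
        rw [this]
        simp only [Finset.card_empty, Nat.cast_zero]
        positivity
      · have hsub : (A.filter fun a => i a ≠ m + 1 ∧ ¬ Disjoint ((F (i a)).image (· * a)) B)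
            ⊆ S.biUnion fun b => ((Finset.range (m + 1)).biUnion
              fun k => (F k)⁻¹ * F (m + 1)).image (· * b) := by
          intro a ha
          rw [Finset.mem_filter] at ha
          obtain ⟨haA, hne', hd⟩ := ha
          rw [Finset.not_disjoint_iff] at hd
          obtain ⟨x, hx1, hx2⟩ := hd
          simp only [hB, Finset.mem_biUnion, Finset.mem_image] at hx1 hx2
          obtain ⟨f, hf, rfl⟩ := hx1
          obtain ⟨b, hb, g, hg, hgb⟩ := hx2
          have hlt : i a < m + 1 := by
            have := hi a haA
            omega
          refine Finset.mem_biUnion.2 ⟨b, hb, Finset.mem_image.2 ⟨f⁻¹ * g, ?_, ?_⟩⟩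
          · exact Finset.mem_biUnion.2 ⟨i a, Finset.mem_range.2 hlt,
              Finset.mul_mem_mul (Finset.inv_mem_inv hf) hg⟩
          · rw [mul_assoc, hgb]
            group
        have hc := (Finset.card_le_card hsub).trans (Finset.card_biUnion_le_card_mul _ _ _
          fun b _ => Finset.card_image_le)
        have hc' : ((A.filter fun a => i a ≠ m + 1 ∧
            ¬ Disjoint ((F (i a)).image (· * a)) B).card : ℝ) ≤ S.card *
            (((Finset.range (m + 1)).biUnion fun k => (F k)⁻¹ * F (m + 1)).card : ℝ) := by
          exact_mod_cast hc
        refine hc'.trans ((mul_le_mul_of_nonneg_left (htemp m) (Nat.cast_nonneg _)).trans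
          (le_of_eq (by ring)))
    have hcard : (A.card : ℝ) = ((A.filter fun a => i a = N).card : ℝ)
        + ((A.filter fun a => i a ≠ N ∧ Disjoint ((F (i a)).image (· * a)) B).card : ℝ)
        + ((A.filter fun a => i a ≠ N ∧ ¬ Disjoint ((F (i a)).image (· * a)) B).card : ℝ) := by
      rw [← Finset.card_filter_add_card_filter_not (s := A) (fun a => i a = N),
        ← Finset.card_filter_add_card_filter_not (s := A.filter fun a => ¬ i a = N)
          (fun a => Disjoint ((F (i a)).image (· * a)) B), Finset.filter_filter,
        Finset.filter_filter]
      push_cast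
      ring
    have hsum := Finset.sum_sdiff (f := φ) hBK
    rw [hcard, ← hsum]
    have h3 : l * ((A.filter fun a => i a ≠ N ∧
        ¬ Disjoint ((F (i a)).image (· * a)) B).card : ℝ) ≤ M * (2 * ∑ x ∈ B, φ x) := by
      refine (mul_le_mul_of_nonneg_left hrem hl).trans ?_
      have := mul_le_mul_of_nonneg_left hS2 hM.le
      linarith
    linarith

end Covering

section Maximal

variable {G : Type*} [Group G] {Y : Type*} [MulAction G Y]

/-- The average of `f` along the finite set `E` of group elements. -/
noncomputable def orbitAvg (E : Finset G) (f : Y → ℝ) (y : Y) : ℝ :=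
  (∑ g ∈ E, f (g • y)) / (E.card : ℝ)

theorem orbitAvg_add (E : Finset G) (f f' : Y → ℝ) (y : Y) :
    orbitAvg E (fun z => f z + f' z) y = orbitAvg E f y + orbitAvg E f' y := by
  simp [orbitAvg, Finset.sum_add_distrib, add_div]

theorem orbitAvg_sub (E : Finset G) (f f' : Y → ℝ) (y : Y) :
    orbitAvg E (fun z => f z - f' z) y = orbitAvg E f y - orbitAvg E f' y := by
  simp [orbitAvg, Finset.sum_sub_distrib, sub_div]

theorem orbitAvg_const_mul (E : Finset G) (c : ℝ) (f : Y → ℝ) (y : Y) :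
    orbitAvg E (fun z => c * f z) y = c * orbitAvg E f y := by
  simp [orbitAvg, ← Finset.mul_sum, mul_div_assoc]

theorem abs_orbitAvg_le (E : Finset G) (f : Y → ℝ) (y : Y) :
    |orbitAvg E f y| ≤ orbitAvg E (fun z => |f z|) y := by
  rw [orbitAvg, orbitAvg, abs_div, abs_of_nonneg (Nat.cast_nonneg (α := ℝ) E.card)]
  exact div_le_div_of_nonneg_right (Finset.abs_sum_le_sum_abs _ _) (Nat.cast_nonneg _)

variable [MeasurableSpace Y] {ν : Measure Y}

theorem ae_forall_smul [Countable G]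
    (hact : ∀ g : G, MeasurePreserving (fun y : Y => g • y) ν ν) {p : Y → Prop}
    (hp : ∀ᵐ y ∂ν, p y) : ∀ᵐ y ∂ν, ∀ g : G, p (g • y) :=
  ae_all_iff.2 fun g => (hact g).quasiMeasurePreserving.ae hp

theorem integral_comp_smul (hact : ∀ g : G, MeasurePreserving (fun y : Y => g • y) ν ν)
    {f : Y → ℝ} (hf : AEStronglyMeasurable f ν) (g : G) :
    ∫ y, f (g • y) ∂ν = ∫ y, f y ∂ν := by
  have := integral_map (μ := ν) (φ := fun y => g • y) (hact g).measurable.aemeasurable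
    (f := f) (by rwa [(hact g).map_eq])
  rw [(hact g).map_eq] at this
  exact this.symm

variable [DecidableEq G]

theorem card_mul_le_add_sum_card_symmDiff (U H : Finset G) :
    (U * H).card ≤ H.card + ∑ u ∈ U, ((H.image (u * ·)) ∆ H).card := by
  have hsub : U * H ⊆ H ∪ U.biUnion fun u => (H.image (u * ·)) ∆ H := by
    intro x hx
    obtain ⟨u, hu, h, hh, rfl⟩ := Finset.mem_mul.1 hx
    by_cases hxH : u * h ∈ H
    · exact Finset.mem_union_left _ hxH
    · refine Finset.mem_union_right _ (Finset.mem_biUnion.2 ⟨u, hu, ?_⟩)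
      exact Finset.mem_symmDiff.2 (Or.inl ⟨Finset.mem_image_of_mem _ hh, hxH⟩)
  exact (Finset.card_le_card hsub).trans ((Finset.card_union_le _ _).trans
    (Nat.add_le_add_left Finset.card_biUnion_le _))

theorem IsFolner.tendsto_sum_card_symmDiff_div {F : ℕ → Finset G} (hF : IsFolner F)
    (U : Finset G) :
    Tendsto (fun n => ((∑ u ∈ U, (((F n).image (u * ·)) ∆ (F n)).card : ℕ) : ℝ)
      / ((F n).card : ℝ)) atTop (𝓝 0) := by
  have := tendsto_finsetSum U fun u _ => hF.2 u
  simpa [Finset.sum_div] using this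

theorem maximal_inequality_finite [IsProbabilityMeasure ν]
    (hact : ∀ g : G, MeasurePreserving (fun y : Y => g • y) ν ν)
    {F : ℕ → Finset G} (hF : IsFolner F) {M : ℝ} (hM : 0 < M)
    (htemp : ∀ n : ℕ, ((((Finset.range (n + 1)).biUnion fun k => (F k)⁻¹ * F (n + 1)).card : ℝ))
      ≤ M * ((F (n + 1)).card : ℝ))
    {f : Y → ℝ} (hf : Integrable f ν) (hf0 : ∀ y, 0 ≤ f y) {l : ℝ} (hl : 0 ≤ l) (N : ℕ) :
    l * ν.real {y | ∃ n < N, l ≤ orbitAvg (F n) f y} ≤ 2 * (1 + M) * ∫ y, f y ∂ν := by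
  classical
  set E : Set Y := {y | ∃ n < N, l ≤ orbitAvg (F n) f y} with hE
  have hcomp : ∀ g : G, Integrable (fun y => f (g • y)) ν := fun g =>
    (hact g).integrable_comp_of_integrable hf
  have hEm : NullMeasurableSet E ν := by
    have : E = ⋃ n ∈ Set.Iio N, {y | l ≤ orbitAvg (F n) f y} := by
      ext y
      simp [hE]
    rw [this]
    refine NullMeasurableSet.biUnion (Set.to_countable _) fun n _ => ?_
    refine nullMeasurableSet_le aemeasurable_const ?_
    exact ((integrable_finsetSum _ fun g _ => hcomp g).div_const _).aemeasurable
  set U : Finset G := (Finset.range N).biUnion F with hU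
  have hpt : ∀ (H : Finset G) (y : Y),
      l * (((H.filter fun h => h • y ∈ E).card : ℕ) : ℝ)
        ≤ 2 * (1 + M) * ∑ x ∈ U * H, f (x • y) := by
    intro H y
    have hex : ∀ a : G, ∃ n, a • y ∈ E → n < N ∧ l ≤ orbitAvg (F n) f (a • y) := by
      intro a
      by_cases ha : a • y ∈ E
      · obtain ⟨n, hn⟩ := ha
        exact ⟨n, fun _ => hn⟩
      · exact ⟨0, fun h => absurd h ha⟩
    choose i hi using hex
    refine IsTempered.card_le_of_forall_le_sum hF.1 hM htemp (fun x => f (x • y))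
      (fun x => hf0 _) hl N _ (U * H) i ?_ ?_ ?_
    · intro a ha
      exact (hi a (Finset.mem_filter.1 ha).2).1
    · intro a ha x hx
      obtain ⟨g, hg, rfl⟩ := Finset.mem_image.1 hx
      have hia := (hi a (Finset.mem_filter.1 ha).2).1
      exact Finset.mul_mem_mul (Finset.mem_biUnion.2 ⟨i a, Finset.mem_range.2 hia, hg⟩)
        (Finset.mem_filter.1 ha).1
    · intro a ha
      have hia := (hi a (Finset.mem_filter.1 ha).2).2
      rw [orbitAvg, le_div_iff₀ (by exact_mod_cast (hF.1 _).card_pos)] at hia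
      rw [Finset.sum_image fun _ _ _ _ h => mul_right_cancel h]
      simpa only [mul_smul] using hia
  have hint : ∀ H : Finset G, l * (H.card * ν.real E)
      ≤ 2 * (1 + M) * ((U * H).card * ∫ y, f y ∂ν) := by
    intro H
    have hEi : Integrable (E.indicator fun _ => (1 : ℝ)) ν :=
      (integrable_const (1 : ℝ)).indicator₀ hEm
    have hEc : ∀ g : G, Integrable (fun y => E.indicator (fun _ => (1 : ℝ)) (g • y)) ν := fun g =>
      (hact g).integrable_comp_of_integrable hEi
    have h1 : ∫ y, l * ∑ h ∈ H, E.indicator (fun _ => (1 : ℝ)) (h • y) ∂ν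
        ≤ ∫ y, 2 * (1 + M) * ∑ x ∈ U * H, f (x • y) ∂ν := by
      refine integral_mono ((integrable_finsetSum _ fun g _ => hEc g).const_mul _)
        ((integrable_finsetSum _ fun g _ => hcomp g).const_mul _) fun y => ?_
      refine le_trans (le_of_eq ?_) (hpt H y)
      simp only [Set.indicator_apply]
      rw [Finset.sum_boole]
    rw [integral_const_mul, integral_const_mul, integral_finsetSum _ fun g _ => hEc g,
      integral_finsetSum _ fun g _ => hcomp g] at h1
    simp only [integral_comp_smul hact hEi.1, integral_comp_smul hact hf.1, Finset.sum_const,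
      nsmul_eq_mul] at h1
    rwa [integral_indicator₀ hEm, setIntegral_const, smul_eq_mul, mul_one] at h1
  have hlim : Tendsto (fun n => 2 * (1 + M) * ((1 +
      ((∑ u ∈ U, (((F n).image (u * ·)) ∆ (F n)).card : ℕ) : ℝ) / ((F n).card : ℝ))
        * ∫ y, f y ∂ν)) atTop (𝓝 (2 * (1 + M) * ((1 + 0) * ∫ y, f y ∂ν))) :=
    ((((hF.tendsto_sum_card_symmDiff_div U).const_add 1)).mul_const _).const_mul _
  rw [add_zero, one_mul] at hlim
  refine ge_of_tendsto' hlim fun n => ?_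
  have hpos : (0 : ℝ) < (F n).card := by exact_mod_cast (hF.1 n).card_pos
  have h2 := hint (F n)
  have h3 : ((U * F n).card : ℝ) ≤ (F n).card
      + ((∑ u ∈ U, (((F n).image (u * ·)) ∆ (F n)).card : ℕ) : ℝ) := by
    exact_mod_cast card_mul_le_add_sum_card_symmDiff U (F n)
  have h4 : 0 ≤ ∫ y, f y ∂ν := integral_nonneg hf0
  refine le_of_mul_le_mul_left ?_ hpos
  calc ((F n).card : ℝ) * (l * ν.real E) = l * ((F n).card * ν.real E) := by ring
    _ ≤ 2 * (1 + M) * ((U * F n).card * ∫ y, f y ∂ν) := h2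
    _ ≤ 2 * (1 + M) * (((F n).card
      + ((∑ u ∈ U, (((F n).image (u * ·)) ∆ (F n)).card : ℕ) : ℝ)) * ∫ y, f y ∂ν) := by
        gcongr
    _ = _ := by
        have : ∀ c s t u : ℝ, 0 < c → u * ((c + s) * t) = c * (u * ((1 + s / c) * t)) := by
          intro c s t u hc
          field_simp
        exact this _ _ _ _ hpos

/-- The weak type `(1, 1)` maximal inequality for averages along a tempered Følner sequence. -/
theorem maximal_inequality [IsProbabilityMeasure ν]
    (hact : ∀ g : G, MeasurePreserving (fun y : Y => g • y) ν ν)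
    {F : ℕ → Finset G} (hF : IsFolner F) {M : ℝ} (hM : 0 < M)
    (htemp : ∀ n : ℕ, ((((Finset.range (n + 1)).biUnion fun k => (F k)⁻¹ * F (n + 1)).card : ℝ))
      ≤ M * ((F (n + 1)).card : ℝ))
    {f : Y → ℝ} (hf : Integrable f ν) (hf0 : ∀ y, 0 ≤ f y) {l : ℝ} (hl : 0 ≤ l) :
    l * ν.real {y | ∃ n, l ≤ orbitAvg (F n) f y} ≤ 2 * (1 + M) * ∫ y, f y ∂ν := by
  have hU : {y | ∃ n, l ≤ orbitAvg (F n) f y}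
      = ⋃ N : ℕ, {y | ∃ n < N, l ≤ orbitAvg (F n) f y} := by
    ext y
    simp only [Set.mem_ofPred_eq, Set.mem_iUnion]
    exact ⟨fun ⟨n, hn⟩ => ⟨n + 1, n, Nat.lt_succ_self n, hn⟩, fun ⟨_, n, _, hn⟩ => ⟨n, hn⟩⟩
  have hmono : Monotone fun N : ℕ => {y | ∃ n < N, l ≤ orbitAvg (F n) f y} :=
    fun a b hab y ⟨n, hn, h⟩ => ⟨n, hn.trans_le hab, h⟩
  have ht := tendsto_measure_iUnion_atTop (μ := ν) hmono
  rw [← hU] at ht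
  have ht' := (ENNReal.tendsto_toReal (measure_ne_top ν _)).comp ht
  refine le_of_tendsto' (ht'.const_mul l) fun N => ?_
  exact maximal_inequality_finite hact hF hM htemp hf hf0 hl N

end Maximal

section InvariantSets

variable {G : Type*} [Group G] {Y : Type*} [MulAction G Y] [MeasurableSpace Y] {ν : Measure Y}

theorem measurableSet_invSigma_iff {D : Set Y} : MeasurableSet[invSigma G ν] D ↔
      MeasurableSet D ∧ ∀ g : G, (fun y => g • y) ⁻¹' D =ᵐ[ν] D := by
  have hgen : ∀ D : Set Y, (∀ g : G, ν ((g • D) ∆ D) = 0) ↔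
      ∀ g : G, (fun y => g • y) ⁻¹' D =ᵐ[ν] D := by
    intro D
    simp only [measure_symmDiff_eq_zero_iff]
    have h : ∀ g : G, (fun y => g • y) ⁻¹' D = g⁻¹ • D := fun g => Set.preimage_smul g D
    refine ⟨fun H g => ?_, fun H g => ?_⟩
    · rw [h]
      exact H g⁻¹
    · have := H g⁻¹
      rwa [h, inv_inv] at this
  constructor
  · intro hD
    refine MeasurableSpace.generateFrom_induction _
      (fun D _ => MeasurableSet D ∧ ∀ g : G, (fun y => g • y) ⁻¹' D =ᵐ[ν] D)
      (fun t ht _ => ⟨ht.1, (hgen t).1 ht.2⟩) ?_ ?_ ?_ D hD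
    · exact ⟨MeasurableSet.empty, fun g => by simp⟩
    · intro t _ ht
      refine ⟨ht.1.compl, fun g => ?_⟩
      rw [Set.preimage_compl]
      exact (ht.2 g).compl
    · intro s _ hs
      refine ⟨MeasurableSet.iUnion fun n => (hs n).1, fun g => ?_⟩
      rw [Set.preimage_iUnion]
      exact Filter.EventuallyEq.countable_iUnion fun n => (hs n).2 g
  · rintro ⟨hD, hD'⟩
    exact MeasurableSpace.measurableSet_generateFrom ⟨hD, (hgen D).2 hD'⟩

theorem invSigma_le :
    invSigma G ν ≤ ‹MeasurableSpace Y› :=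
  fun _ hD => ((measurableSet_invSigma_iff).1 hD).1

theorem comp_smul_ae_eq_of_measurable_invSigma
    {f : Y → ℝ}
    (hf : Measurable[invSigma G ν] f) (g : G) : ∀ᵐ y ∂ν, f (g • y) = f y := by
  have h : ∀ q : ℚ, ∀ᵐ y ∂ν, f (g • y) < q ↔ f y < q := by
    intro q
    have hq : MeasurableSet[invSigma G ν] (f ⁻¹' Set.Iio (q : ℝ)) := hf measurableSet_Iio
    filter_upwards [((measurableSet_invSigma_iff).1 hq).2 g] with y hy
    exact iff_of_eq hy
  filter_upwards [ae_all_iff.2 h] with y hy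
  refine le_antisymm ?_ ?_
  · by_contra! hlt
    obtain ⟨q, hq1, hq2⟩ := exists_rat_btwn hlt
    exact absurd ((hy q).2 hq1) hq2.not_gt
  · by_contra! hlt
    obtain ⟨q, hq1, hq2⟩ := exists_rat_btwn hlt
    exact absurd ((hy q).1 hq1) hq2.not_gt

theorem measurable_invSigma_of_comp_smul_ae_eq {f : Y → ℝ}
    (hf : Measurable f) (hinv : ∀ g : G, ∀ᵐ y ∂ν, f (g • y) = f y) :
    Measurable[invSigma G ν] f := by
  intro s hs
  refine (measurableSet_invSigma_iff).2 ⟨hf hs, fun g => ?_⟩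
  filter_upwards [hinv g] with y hy
  change (f (g • y) ∈ s) = (f y ∈ s)
  rw [hy]

theorem condExp_comp_smul_ae_eq [IsProbabilityMeasure ν]
    {f : Y → ℝ} (g : G) :
    ∀ᵐ y ∂ν, (ν[f | invSigma G ν]) (g • y) = (ν[f | invSigma G ν]) y :=
  comp_smul_ae_eq_of_measurable_invSigma stronglyMeasurable_condExp.measurable g

theorem condExp_of_comp_smul [IsProbabilityMeasure ν]
    (hact : ∀ g : G, MeasurePreserving (fun y : Y => g • y) ν ν) {f : Y → ℝ}
    (hf : Integrable f ν) (g : G) :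
    ν[fun y => f (g • y) | invSigma G ν] =ᵐ[ν] ν[f | invSigma G ν] := by
  have hfg : Integrable (fun y => f (g • y)) ν := (hact g).integrable_comp_of_integrable hf
  refine (ae_eq_condExp_of_forall_setIntegral_eq invSigma_le hfg
    (fun s _ _ => integrable_condExp.integrableOn) (fun s hs _ => ?_)
    stronglyMeasurable_condExp.aestronglyMeasurable).symm
  obtain ⟨hsm, hsi⟩ := (measurableSet_invSigma_iff).1 hs
  calc ∫ y in s, (ν[f | invSigma G ν]) y ∂ν = ∫ y in s, f y ∂ν :=
        setIntegral_condExp invSigma_le hf hs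
    _ = ∫ y, s.indicator f (g • y) ∂ν := by
        rw [integral_comp_smul hact (hf.1.indicator hsm) g, integral_indicator hsm]
    _ = ∫ y in (fun y => g • y) ⁻¹' s, f (g • y) ∂ν :=
        integral_indicator (f := fun y => f (g • y)) ((hact g).measurable hsm)
    _ = ∫ y in s, f (g • y) ∂ν := setIntegral_congr_set (hsi g)

end InvariantSets

theorem abs_sum_sub_sum_le_card_symmDiff {G : Type*} [DecidableEq G] (A B : Finset G) (u : G → ℝ)
    (hu : ∀ x, |u x| ≤ 1) : |∑ x ∈ A, u x - ∑ x ∈ B, u x| ≤ ((B ∆ A).card : ℝ) := by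
  have h1 := Finset.sum_inter_add_sum_sdiff A B u
  have h2 := Finset.sum_inter_add_sum_sdiff B A u
  have hb : ∀ S : Finset G, |∑ x ∈ S, u x| ≤ S.card := fun S => by
    refine (Finset.abs_sum_le_sum_abs _ _).trans ((Finset.sum_le_card_nsmul _ _ 1
      fun x _ => hu x).trans ?_)
    simp
  have hc : (B ∆ A).card = (B \ A).card + (A \ B).card :=
    Finset.card_union_of_disjoint disjoint_sdiff_sdiff
  rw [← h1, ← h2, Finset.inter_comm B A, add_sub_add_left_eq_sub, hc]
  push_cast
  have := abs_sub (∑ x ∈ A \ B, u x) (∑ x ∈ B \ A, u x)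
  linarith [hb (A \ B), hb (B \ A)]

section PointwiseErgodic

variable {G : Type*} [Group G] {Y : Type*} [MulAction G Y] [MeasurableSpace Y]

/-- The averages of the integrable function `f` along `F` converge almost everywhere to the
conditional expectation of `f` on the invariant `σ`-algebra. -/
def AvgTendstoCondExp (ν : Measure Y) (F : ℕ → Finset G) (f : Y → ℝ) : Prop :=
  Integrable f ν ∧
    ∀ᵐ y ∂ν, Tendsto (fun n => orbitAvg (F n) f y) atTop (𝓝 ((ν[f | invSigma G ν]) y))

variable {ν : Measure Y} {F : ℕ → Finset G} {f f' : Y → ℝ}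

theorem AvgTendstoCondExp.congr [Countable G]
    (hact : ∀ g : G, MeasurePreserving (fun y : Y => g • y) ν ν)
    (hf : AvgTendstoCondExp ν F f) (h : f =ᵐ[ν] f') : AvgTendstoCondExp ν F f' := by
  refine ⟨hf.1.congr h, ?_⟩
  filter_upwards [hf.2, ae_forall_smul hact h, condExp_congr_ae (m := invSigma G ν) h]
    with y h1 h2 h3
  rw [← h3]
  refine h1.congr fun n => ?_
  simp only [orbitAvg, h2]

theorem AvgTendstoCondExp.add (hf : AvgTendstoCondExp ν F f) (hf' : AvgTendstoCondExp ν F f') :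
    AvgTendstoCondExp ν F (fun y => f y + f' y) := by
  refine ⟨hf.1.add hf'.1, ?_⟩
  filter_upwards [hf.2, hf'.2, condExp_add hf.1 hf'.1 (invSigma G ν)] with y h1 h2 h3
  have h4 : (ν[fun y => f y + f' y | invSigma G ν]) y
      = (ν[f | invSigma G ν]) y + (ν[f' | invSigma G ν]) y := h3
  rw [h4]
  simpa only [orbitAvg_add] using h1.add h2

theorem AvgTendstoCondExp.const_mul (hf : AvgTendstoCondExp ν F f) (c : ℝ) :
    AvgTendstoCondExp ν F (fun y => c * f y) := by
  refine ⟨hf.1.const_mul c, ?_⟩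
  filter_upwards [hf.2, condExp_smul c f (invSigma G ν)] with y h1 h2
  have h4 : (ν[fun y => c * f y | invSigma G ν]) y = c * (ν[f | invSigma G ν]) y := h2
  rw [h4]
  simpa only [orbitAvg_const_mul] using h1.const_mul c

theorem avgTendstoCondExp_of_comp_smul_ae_eq [Countable G] [IsProbabilityMeasure ν]
    (hact : ∀ g : G, MeasurePreserving (fun y : Y => g • y) ν ν) (hF : ∀ n, (F n).Nonempty)
    (hf : Integrable f ν) (hinv : ∀ g : G, ∀ᵐ y ∂ν, f (g • y) = f y) :
    AvgTendstoCondExp ν F f := by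
  have hmk : f =ᵐ[ν] hf.1.mk f := hf.1.ae_eq_mk
  have hmki : ∀ g : G, ∀ᵐ y ∂ν, hf.1.mk f (g • y) = hf.1.mk f y := by
    intro g
    filter_upwards [hinv g, hmk, ae_forall_smul hact hmk] with y h1 h2 h3
    rw [← h3, ← h2, h1]
  have hmeas := measurable_invSigma_of_comp_smul_ae_eq hf.1.measurable_mk hmki
  have hce : ν[f | invSigma G ν] =ᵐ[ν] f := by
    refine (condExp_congr_ae hmk).trans ?_
    rw [condExp_of_stronglyMeasurable invSigma_le hmeas.stronglyMeasurable
      (hf.congr hmk)]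
    exact hmk.symm
  refine ⟨hf, ?_⟩
  filter_upwards [hce, ae_all_iff.2 hinv] with y h1 h2
  rw [h1]
  refine tendsto_const_nhds.congr fun n => ?_
  have : ((F n).card : ℝ) ≠ 0 := by exact_mod_cast (hF n).card_pos.ne'
  simp only [orbitAvg, h2, Finset.sum_const, nsmul_eq_mul]
  field_simp

theorem avgTendstoCondExp_indicator_coboundary [DecidableEq G] [IsProbabilityMeasure ν]
    (hact : ∀ g : G, MeasurePreserving (fun y : Y => g • y) ν ν) (hF : IsFolner F)
    {D : Set Y} (hD : MeasurableSet D) (g : G) :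
    AvgTendstoCondExp ν F
      (fun y => D.indicator (fun _ => (1 : ℝ)) y - D.indicator (fun _ => (1 : ℝ)) (g • y)) := by
  set h : Y → ℝ := D.indicator fun _ => (1 : ℝ) with hh
  have hi : Integrable h ν := (integrable_const (1 : ℝ)).indicator hD
  have hig : Integrable (fun y => h (g • y)) ν := (hact g).integrable_comp_of_integrable hi
  refine ⟨hi.sub hig, ?_⟩
  filter_upwards [condExp_sub hi hig (invSigma G ν), condExp_of_comp_smul hact hi g]
    with y h1 h2
  have h3 : (ν[fun y => h y - h (g • y) | invSigma G ν]) y = 0 := by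
    refine h1.trans ?_
    rw [Pi.sub_apply, h2, sub_self]
  rw [h3]
  refine squeeze_zero_norm (fun n => ?_) (hF.2 g)
  have hsum : ∑ x ∈ F n, h (g • x • y) = ∑ x ∈ (F n).image (g * ·), h (x • y) := by
    rw [Finset.sum_image fun _ _ _ _ h => mul_left_cancel h]
    simp only [mul_smul]
  rw [orbitAvg, Finset.sum_sub_distrib, hsum, Real.norm_eq_abs, abs_div,
    abs_of_nonneg (Nat.cast_nonneg (α := ℝ) _)]
  refine div_le_div_of_nonneg_right ?_ (Nat.cast_nonneg _)
  refine abs_sum_sub_sum_le_card_symmDiff _ _ (fun x => h (x • y)) fun x => ?_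
  by_cases hx : x • y ∈ D <;> simp [hh, hx]

theorem avgTendstoCondExp_of_forall_exists [DecidableEq G] [IsProbabilityMeasure ν]
    (hact : ∀ g : G, MeasurePreserving (fun y : Y => g • y) ν ν) (hF : IsFolner F)
    (htemp : IsTempered F) (hf : Integrable f ν)
    (h : ∀ ε : ℝ, 0 < ε → ∃ f', AvgTendstoCondExp ν F f' ∧ ∫ y, |f y - f' y| ∂ν ≤ ε) :
    AvgTendstoCondExp ν F f := by
  obtain ⟨M, hM, htemp⟩ := htemp
  refine ⟨hf, ?_⟩
  have key : ∀ δ : ℝ, 0 < δ → ∀ᵐ y ∂ν, ∀ᶠ n in atTop,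
      |orbitAvg (F n) f y - (ν[f | invSigma G ν]) y| < 3 * δ := by
    intro δ hδ
    set B : Set Y :=
      {y | ¬ ∀ᶠ n in atTop, |orbitAvg (F n) f y - (ν[f | invSigma G ν]) y| < 3 * δ} with hB
    have hle : ∀ ε : ℝ, 0 < ε → δ * ν.real B ≤ (2 * (1 + M) + 1) * ε := by
      intro ε hε
      obtain ⟨f', hf', hfε⟩ := h ε hε
      set S₁ : Set Y := {y | ∃ n, δ ≤ orbitAvg (F n) (fun z => |f z - f' z|) y} with hS₁
      set S₂ : Set Y := {y | δ ≤ |(ν[f - f' | invSigma G ν]) y|} with hS₂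
      have hsub : B ≤ᵐ[ν] (S₁ ∪ S₂ : Set Y) := by
        filter_upwards [hf'.2, condExp_sub hf hf'.1 (invSigma G ν)] with y h1 h2
        change y ∈ B → y ∈ S₁ ∪ S₂
        contrapose!
        intro hy hyB
        simp only [Set.mem_union, hS₁, hS₂, Set.mem_ofPred_eq, not_or, not_exists, not_le] at hy
        refine hyB ?_
        filter_upwards [(Metric.tendsto_nhds.1 h1) δ hδ] with n hn
        rw [Real.dist_eq] at hn
        have h3 := (abs_orbitAvg_le (F n) (fun z => f z - f' z) y).trans_lt (hy.1 n)
        rw [orbitAvg_sub] at h3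
        have h4 := hy.2
        rw [h2, Pi.sub_apply] at h4
        rw [abs_lt] at *
        constructor <;> linarith [h3.1, h3.2, h4.1, h4.2, hn.1, hn.2]
      have h1 : ν.real B ≤ ν.real S₁ + ν.real S₂ :=
        (ENNReal.toReal_mono (measure_ne_top _ _) (measure_mono_ae hsub)).trans
          (measureReal_union_le _ _)
      have h2 := maximal_inequality hact hF hM htemp (hf.sub hf'.1).abs
        (fun y => abs_nonneg _) hδ.le
      have h3 := mul_meas_ge_le_integral_of_nonneg (μ := ν)
        (f := fun y => |(ν[f - f' | invSigma G ν]) y|) (ae_of_all _ fun y => abs_nonneg _)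
        integrable_condExp.abs δ
      have h4 := h3.trans (integral_abs_condExp_le (f - f'))
      simp only [Pi.sub_apply] at h2 h4
      calc δ * ν.real B ≤ δ * (ν.real S₁ + ν.real S₂) := by gcongr
        _ = δ * ν.real S₁ + δ * ν.real S₂ := mul_add _ _ _
        _ ≤ 2 * (1 + M) * (∫ y, |f y - f' y| ∂ν) + ∫ y, |f y - f' y| ∂ν := add_le_add h2 h4
        _ = (2 * (1 + M) + 1) * ∫ y, |f y - f' y| ∂ν := by ring
        _ ≤ (2 * (1 + M) + 1) * ε := by gcongr
    have hzero : δ * ν.real B ≤ 0 := by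
      refine le_of_forall_pos_le_add fun η hη => ?_
      have hc : 0 < 2 * (1 + M) + 1 := by positivity
      have := hle (η / (2 * (1 + M) + 1)) (by positivity)
      rwa [mul_div_cancel₀ _ hc.ne', ← zero_add η] at this
    have h0 : ν.real B = 0 :=
      le_antisymm (by nlinarith [measureReal_nonneg (μ := ν) (s := B)]) measureReal_nonneg
    rw [measureReal_eq_zero_iff] at h0
    exact h0
  have hall := ae_all_iff.2 fun k : ℕ => key (1 / (3 * ((k : ℝ) + 1))) (by positivity)
  filter_upwards [hall] with y hy
  refine Metric.tendsto_nhds.2 fun ε hε => ?_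
  obtain ⟨k, hk⟩ := exists_nat_one_div_lt hε
  filter_upwards [hy k] with n hn
  rw [Real.dist_eq]
  refine hn.trans_le (le_trans (le_of_eq ?_) hk.le)
  field_simp

theorem integral_abs_sub_le_of_eLpNorm_le {p : ℝ≥0∞} (hp : 1 ≤ p) [IsProbabilityMeasure ν]
    (hf : Integrable f ν) (hf' : Integrable f' ν) {ε : ℝ} (hε : 0 ≤ ε)
    (h : eLpNorm (f - f') p ν ≤ ENNReal.ofReal ε) : ∫ y, |f y - f' y| ∂ν ≤ ε := by
  have h1 := (eLpNorm_le_eLpNorm_of_exponent_le hp (hf.sub hf').1).trans h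
  rw [eLpNorm_one_eq_lintegral_enorm] at h1
  have h2 := integral_norm_eq_lintegral_enorm (hf.sub hf').1
  have h3 := ENNReal.toReal_mono ENNReal.ofReal_ne_top h1
  rw [← h2, ENNReal.toReal_ofReal hε] at h3
  exact h3

theorem avgTendstoCondExp_of_memLp_two [Countable G] [DecidableEq G] [IsProbabilityMeasure ν]
    (hact : ∀ g : G, MeasurePreserving (fun y : Y => g • y) ν ν) (hF : IsFolner F)
    (htemp : IsTempered F) (hf : MemLp f 2 ν) : AvgTendstoCondExp ν F f := by
  have hLp : ∀ k : Lp ℝ 2 ν, Integrable k ν := fun k => (Lp.memLp k).integrable one_le_two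
  let W : Submodule ℝ (Lp ℝ 2 ν) :=
    { carrier := {k | AvgTendstoCondExp ν F k}
      add_mem' := fun {a b} ha hb => (ha.add hb).congr hact (Lp.coeFn_add a b).symm
      zero_mem' := by
        refine avgTendstoCondExp_of_comp_smul_ae_eq hact hF.1 (hLp 0) fun g => ?_
        filter_upwards [Lp.coeFn_zero ℝ 2 ν, ae_forall_smul hact (Lp.coeFn_zero ℝ 2 ν)]
          with y h1 h2
        rw [h1, h2 g]
        rfl
      smul_mem' := fun c k hk => (hk.const_mul c).congr hact (Lp.coeFn_smul c k).symm }
  have hWc : IsClosed (W : Set (Lp ℝ 2 ν)) := by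
    refine isClosed_of_closure_subset fun k hk => ?_
    refine avgTendstoCondExp_of_forall_exists hact hF htemp (hLp k) fun ε hε => ?_
    obtain ⟨k', hk', hd⟩ := Metric.mem_closure_iff.1 hk ε hε
    refine ⟨k', hk', integral_abs_sub_le_of_eLpNorm_le one_le_two (hLp k) (hLp k') hε.le ?_⟩
    rw [← Lp.edist_def, edist_dist]
    exact ENNReal.ofReal_le_ofReal hd.le
  have : CompleteSpace W := hWc.completeSpace_coe
  have hWtop : W = ⊤ := by
    rw [← Submodule.orthogonal_eq_bot_iff, Submodule.eq_bot_iff]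
    intro k hk
    have hinv : ∀ g : G, ∀ᵐ y ∂ν, k (g⁻¹ • y) = k y := by
      intro g
      have hkg : Integrable (fun y => k (g⁻¹ • y)) ν :=
        (hact g⁻¹).integrable_comp_of_integrable (hLp k)
      refine Integrable.ae_eq_of_forall_setIntegral_eq _ _ hkg (hLp k) fun D hD _ => ?_
      have hD' : MeasurableSet ((fun y => g • y) ⁻¹' D) := (hact g).measurable hD
      have hmem : indicatorConstLp 2 hD (measure_ne_top ν _) (1 : ℝ)
          - indicatorConstLp 2 hD' (measure_ne_top ν _) (1 : ℝ) ∈ W := by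
        refine (avgTendstoCondExp_indicator_coboundary hact hF hD g).congr hact ?_
        refine EventuallyEq.trans ?_ (Lp.coeFn_sub _ _).symm
        filter_upwards [indicatorConstLp_coeFn (p := 2) (hs := hD)
          (hμs := measure_ne_top ν _) (c := (1 : ℝ)), indicatorConstLp_coeFn (p := 2) (hs := hD')
          (hμs := measure_ne_top ν _) (c := (1 : ℝ))] with y h1 h2
        rw [Pi.sub_apply, h1, h2]
        rfl
      have horth := (Submodule.mem_orthogonal W k).1 hk _ hmem
      rw [inner_sub_left, L2.inner_indicatorConstLp_one, L2.inner_indicatorConstLp_one,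
        sub_eq_zero] at horth
      rw [horth, ← integral_indicator hD, ← integral_indicator hD',
        ← integral_comp_smul hact (hkg.1.indicator hD) g]
      refine integral_congr_ae (ae_of_all _ fun y => ?_)
      by_cases hy : g • y ∈ D <;> simp [Set.indicator, hy]
    have hkW : k ∈ W := by
      refine avgTendstoCondExp_of_comp_smul_ae_eq hact hF.1 (hLp k) fun g => ?_
      simpa using hinv g⁻¹
    exact inner_self_eq_zero.1 ((Submodule.mem_orthogonal W k).1 hk k hkW)
  have hfW : hf.toLp f ∈ W := hWtop ▸ Submodule.mem_top
  exact AvgTendstoCondExp.congr hact hfW hf.coeFn_toLp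

/-- The pointwise ergodic theorem along tempered Følner sequences. -/
theorem avgTendstoCondExp [Countable G] [DecidableEq G] [IsProbabilityMeasure ν]
    (hact : ∀ g : G, MeasurePreserving (fun y : Y => g • y) ν ν) (hF : IsFolner F)
    (htemp : IsTempered F) (hf : Integrable f ν) : AvgTendstoCondExp ν F f := by
  refine avgTendstoCondExp_of_forall_exists hact hF htemp hf fun ε hε => ?_
  obtain ⟨s, hs, hs1⟩ := (memLp_one_iff_integrable.2 hf).exists_simpleFunc_eLpNorm_sub_lt
    ENNReal.one_ne_top (ε := ENNReal.ofReal ε) (by simpa using hε)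
  exact ⟨s, avgTendstoCondExp_of_memLp_two hact hF htemp (s.memLp_of_isFiniteMeasure 2 ν),
    integral_abs_sub_le_of_eLpNorm_le le_rfl hf (memLp_one_iff_integrable.1 hs1) hε.le hs.le⟩

end PointwiseErgodic

section Submodular

theorem card_mul_le_sum_of_submodular {G ι : Type*} [DecidableEq G] {a : Finset G → ℝ}
    (h0 : a ∅ = 0)
    (hsub : ∀ A B : Finset G, a (A ∩ B) + a (A ∪ B) ≤ a A + a B) (hneg : ∀ g, a {g} ≤ 0)
    (k : ℕ) (T : Finset ι) (F : Finset G) :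
    ∀ A : ι → Finset G, (∀ i ∈ T, A i ⊆ F) → (∀ x, (T.filter fun i => x ∈ A i).card ≤ k) →
      (k : ℝ) * a F ≤ ∑ i ∈ T, a (A i) := by
  induction F using Finset.induction_on with
  | empty =>
    intro A hA _
    rw [h0, mul_zero, Finset.sum_eq_zero]
    intro i hi
    rw [Finset.subset_empty.1 (hA i hi), h0]
  | insert x F hx ih =>
    intro A hA hk
    have hrec := ih (fun i => A i ∩ F) (fun i _ => Finset.inter_subset_right) fun z =>
      (Finset.card_le_card (Finset.monotone_filter_right T fun i _ hi =>
        (Finset.mem_inter.1 hi).1)).trans (hk z)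
    have hΔ : a (insert x F) - a F ≤ 0 := by
      have := hsub {x} F
      rw [Finset.singleton_inter_of_notMem hx, h0, ← Finset.insert_eq] at this
      linarith [hneg x]
    have hstep : ∀ i ∈ T, a (A i ∩ F) + (if x ∈ A i then a (insert x F) - a F else 0)
        ≤ a (A i) := by
      intro i hi
      split_ifs with hxi
      · have := hsub (A i) F
        have hU : A i ∪ F = insert x F := by
          refine Finset.Subset.antisymm
            (Finset.union_subset (hA i hi) (Finset.subset_insert _ _)) ?_
          exact Finset.insert_subset (Finset.mem_union_left _ hxi) Finset.subset_union_right
        rw [hU] at this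
        linarith
      · have : A i ∩ F = A i := by
          refine Finset.inter_eq_left.2 fun z hz => ?_
          refine (Finset.mem_insert.1 (hA i hi hz)).resolve_left ?_
          rintro rfl
          exact hxi hz
        rw [this, add_zero]
    have hsum := Finset.sum_le_sum hstep
    rw [Finset.sum_add_distrib, ← Finset.sum_filter, Finset.sum_const, nsmul_eq_mul] at hsum
    have hkx : ((T.filter fun i => x ∈ A i).card : ℝ) ≤ k := by exact_mod_cast hk x
    nlinarith [mul_le_mul_of_nonpos_right hkx hΔ]

variable {G : Type*} [Group G] [DecidableEq G]

theorem card_mul_le_sum_translates_of_submodular {a : Finset G → ℝ} (h0 : a ∅ = 0)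
    (hsub : ∀ A B : Finset G, a (A ∩ B) + a (A ∪ B) ≤ a A + a B) (hneg : ∀ g, a {g} ≤ 0)
    (E F : Finset G) :
    (E.card : ℝ) * a F
      ≤ ∑ f ∈ F.filter (fun f => E.image (· * f) ⊆ F), a (E.image (· * f)) := by
  refine card_mul_le_sum_of_submodular h0 hsub hneg E.card _ F _
    (fun f hf => (Finset.mem_filter.1 hf).2) fun x => ?_
  refine (Finset.card_le_card (t := E.image fun e => e⁻¹ * x) fun f hf => ?_).trans
    Finset.card_image_le
  obtain ⟨e, he, rfl⟩ := Finset.mem_image.1 (Finset.mem_filter.1 hf).2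
  exact Finset.mem_image.2 ⟨e, he, by group⟩

theorem card_filter_not_translate_subset_le (E F : Finset G) :
    (F.filter fun f => ¬ E.image (· * f) ⊆ F).card
      ≤ ∑ e ∈ E, ((F.image (e * ·)) ∆ F).card := by
  have hsub : (F.filter fun f => ¬ E.image (· * f) ⊆ F)
      ⊆ E.biUnion fun e => F.filter fun f => e * f ∉ F := by
    intro f hf
    obtain ⟨hfF, hf⟩ := Finset.mem_filter.1 hf
    obtain ⟨x, hx, hxF⟩ := Finset.not_subset.1 hf
    obtain ⟨e, he, rfl⟩ := Finset.mem_image.1 hx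
    exact Finset.mem_biUnion.2 ⟨e, he, Finset.mem_filter.2 ⟨hfF, hxF⟩⟩
  refine (Finset.card_le_card hsub).trans (Finset.card_biUnion_le.trans
    (Finset.sum_le_sum fun e _ => ?_))
  refine Finset.card_le_card_of_injOn (e * ·) (fun f hf => ?_) fun _ _ _ _ h => mul_left_cancel h
  obtain ⟨hfF, hf⟩ := Finset.mem_filter.1 hf
  exact Finset.mem_symmDiff.2 (Or.inl ⟨Finset.mem_image_of_mem _ hfF, hf⟩)

end Submodular

section ReducedFamily

/-- The conditions at a point `y` satisfied almost everywhere by a strongly sub-additive invariant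
family after subtracting its additive part. -/
structure IsReducedAt {G : Type*} [Group G] {Y : Type*} [MulAction G Y] [DecidableEq G]
    (a : Finset G → Y → ℝ) (y : Y) : Prop where
  empty : a ∅ y = 0
  submodular : ∀ A B : Finset G, a (A ∩ B) y + a (A ∪ B) y ≤ a A y + a B y
  singleton : ∀ g, a {g} y = 0
  equivariant : ∀ (E : Finset G) (g : G), a (E.image (· * g)) y = a E (g • y)

theorem IsReducedAt.nonpos {G : Type*} [Group G] {Y : Type*} [MulAction G Y] [DecidableEq G]
    {a : Finset G → Y → ℝ} {y : Y} (h : IsReducedAt a y)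
    (E : Finset G) :
    a E y ≤ 0 := by
  induction E using Finset.induction_on with
  | empty => exact h.empty.le
  | insert x E hx ih =>
    have := h.submodular {x} E
    rw [Finset.singleton_inter_of_notMem hx, h.empty, h.singleton, ← Finset.insert_eq] at this
    linarith

variable {G : Type*} [Group G] {Y : Type*} [MulAction G Y] [MeasurableSpace Y] {ν : Measure Y}

theorem ae_forall_exists_condExp_lt [IsProbabilityMeasure ν] (m : MeasurableSpace Y)
    {r : ℕ → Y → ℝ} (hr0 : ∀ k y, 0 ≤ r k y)
    (hlim : Tendsto (fun k => ∫ y, r k y ∂ν) atTop (𝓝 0)) :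
    ∀ᵐ y ∂ν, ∀ δ : ℝ, 0 < δ → ∃ k, (ν[r k | m]) y < δ := by
  have key : ∀ δ : ℝ, 0 < δ → ∀ᵐ y ∂ν, ∃ k, (ν[r k | m]) y < δ := by
    intro δ hδ
    set B : Set Y := {y | ¬ ∃ k, (ν[r k | m]) y < δ} with hB
    have hle : ∀ k, δ * ν.real B ≤ ∫ y, r k y ∂ν := by
      intro k
      have h1 := mul_meas_ge_le_integral_of_nonneg (μ := ν)
        (f := fun y => |(ν[r k | m]) y|) (ae_of_all _ fun y => abs_nonneg _)
        integrable_condExp.abs δ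
      have h2 := h1.trans (integral_abs_condExp_le (r k))
      simp only [abs_of_nonneg (hr0 k _)] at h2
      refine le_trans ?_ h2
      refine mul_le_mul_of_nonneg_left (measureReal_mono fun y hy => ?_) hδ.le
      simp only [hB, Set.mem_ofPred_eq, not_exists, not_lt] at hy
      exact (hy k).trans (le_abs_self _)
    have hzero : δ * ν.real B ≤ 0 := ge_of_tendsto' hlim hle
    have h0 : ν.real B = 0 :=
      le_antisymm (by nlinarith [measureReal_nonneg (μ := ν) (s := B)]) measureReal_nonneg
    rw [measureReal_eq_zero_iff] at h0
    exact h0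
  have hall := ae_all_iff.2 fun k : ℕ => key (1 / ((k : ℝ) + 1)) (by positivity)
  filter_upwards [hall] with y hy δ hδ
  obtain ⟨n, hn⟩ := exists_nat_one_div_lt hδ
  obtain ⟨k, hk⟩ := hy n
  exact ⟨k, hk.trans hn⟩

variable [DecidableEq G]

theorem ae_eventually_reduced_le [Countable G] [IsProbabilityMeasure ν]
    (hact : ∀ g : G, MeasurePreserving (fun y : Y => g • y) ν ν) {F : ℕ → Finset G}
    (hF : IsFolner F) (htemp : IsTempered F) {a : Finset G → Y → ℝ}
    (hint : ∀ E, Integrable (a E) ν) (ha : ∀ᵐ y ∂ν, IsReducedAt a y) {E : Finset G}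
    (hE : E.Nonempty) :
    ∀ᵐ y ∂ν, ∀ ε : ℝ, 0 < ε → ∀ᶠ n in atTop,
      ((F n).card : ℝ)⁻¹ * a (F n) y
        ≤ (E.card : ℝ)⁻¹ * (ν[a E | invSigma G ν]) y + ε := by
  set φ : ℕ → Y → ℝ := fun k y => max (a E y) (-k) with hφ
  have hφi : ∀ k, Integrable (φ k) ν := fun k => (hint E).sup (integrable_const _)
  have hlim : Tendsto (fun k => ∫ y, (φ k - a E) y ∂ν) atTop (𝓝 0) := by
    have := tendsto_integral_of_dominated_convergence (μ := ν) (F := fun k : ℕ => φ k - a E)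
      (f := fun _ => (0 : ℝ)) (fun y => |a E y|)
      (fun k => ((hφi k).sub (hint E)).1) (hint E).abs
      (fun k => ae_of_all _ fun y => ?_) (ae_of_all _ fun y => ?_)
    · simpa using this
    · simp only [hφ, Pi.sub_apply, Real.norm_eq_abs]
      have hk : (0 : ℝ) ≤ k := Nat.cast_nonneg k
      rcases max_cases (a E y) (-(k : ℝ)) with ⟨h, _⟩ | ⟨h, h'⟩ <;> rw [h]
      · simp
      · rw [abs_of_nonneg (by linarith), abs_of_nonpos (by linarith)]
        linarith
    · obtain ⟨k, hk⟩ := exists_nat_ge (-a E y)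
      refine tendsto_const_nhds.congr' ?_
      filter_upwards [eventually_ge_atTop k] with j hj
      have hjk : (k : ℝ) ≤ j := by exact_mod_cast hj
      simp only [hφ, Pi.sub_apply]
      rw [max_eq_left (by linarith), sub_self]
  have hsmall := ae_forall_exists_condExp_lt (invSigma G ν)
    (fun k y => sub_nonneg.2 (le_max_left (a E y) (-(k : ℝ)))) hlim
  filter_upwards [ha, hsmall, ae_all_iff.2 fun k => (avgTendstoCondExp hact hF htemp (hφi k)).2,
    ae_all_iff.2 fun k => condExp_sub (hφi k) (hint E) (invSigma G ν)] with y hy h1 h2 h3 ε hε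
  obtain ⟨k, hk⟩ := h1 (ε / 3) (by positivity)
  have hk' : (ν[φ k | invSigma G ν]) y < (ν[a E | invSigma G ν]) y + ε / 3 := by
    have := (h3 k).symm.trans_lt hk
    rw [Pi.sub_apply] at this
    linarith
  have hbad := (hF.tendsto_sum_card_symmDiff_div E).const_mul (k : ℝ)
  rw [mul_zero] at hbad
  filter_upwards [(h2 k).eventually_lt_const (u := (ν[φ k | invSigma G ν]) y + ε / 3)
    (by linarith), hbad.eventually_lt_const (u := ε / 3) (by positivity)] with n hn1 hn2
  have hpos : (0 : ℝ) < (F n).card := by exact_mod_cast (hF.1 n).card_pos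
  have hEpos : (0 : ℝ) < E.card := by exact_mod_cast hE.card_pos
  have hE1 : (E.card : ℝ)⁻¹ ≤ 1 := inv_le_one_of_one_le₀ (by exact_mod_cast hE.card_pos)
  have hsh := card_mul_le_sum_translates_of_submodular (a := fun A => a A y) hy.empty
    hy.submodular (fun g => (hy.singleton g).le) E (F n)
  have hle : (E.card : ℝ) * a (F n) y ≤ ∑ f ∈ F n, φ k (f • y)
      + k * ((∑ e ∈ E, (((F n).image (e * ·)) ∆ (F n)).card : ℕ) : ℝ) := by
    have hb : ((((F n).filter fun f => ¬ E.image (· * f) ⊆ F n).card : ℕ) : ℝ)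
        ≤ ((∑ e ∈ E, (((F n).image (e * ·)) ∆ (F n)).card : ℕ) : ℝ) := by
      exact_mod_cast card_filter_not_translate_subset_le E (F n)
    have hgood : ∑ f ∈ (F n).filter (fun f => E.image (· * f) ⊆ F n), a (E.image (· * f)) y
        ≤ ∑ f ∈ (F n).filter (fun f => E.image (· * f) ⊆ F n), φ k (f • y) :=
      Finset.sum_le_sum fun f _ => by
        rw [hy.equivariant]
        exact le_max_left _ _
    have hbads : ((((F n).filter fun f => ¬ E.image (· * f) ⊆ F n).card : ℕ) : ℝ) * (-(k : ℝ))
        ≤ ∑ f ∈ (F n).filter (fun f => ¬ E.image (· * f) ⊆ F n), φ k (f • y) := by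
      rw [← nsmul_eq_mul]
      exact Finset.card_nsmul_le_sum _ _ _ fun f _ => le_max_right _ _
    rw [← Finset.sum_filter_add_sum_filter_not (F n) (fun f => E.image (· * f) ⊆ F n)
      (fun f => φ k (f • y))]
    nlinarith [mul_le_mul_of_nonneg_left hb (Nat.cast_nonneg (α := ℝ) k)]
  have hmain : ((F n).card : ℝ)⁻¹ * a (F n) y
      ≤ (E.card : ℝ)⁻¹ * ((ν[a E | invSigma G ν]) y + ε) := by
    calc ((F n).card : ℝ)⁻¹ * a (F n) y
        = (E.card : ℝ)⁻¹ * ((E.card : ℝ) * a (F n) y / (F n).card) := by field_simp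
      _ ≤ (E.card : ℝ)⁻¹ * ((∑ f ∈ F n, φ k (f • y)
          + k * ((∑ e ∈ E, (((F n).image (e * ·)) ∆ (F n)).card : ℕ) : ℝ)) / (F n).card) := by
          gcongr
      _ = (E.card : ℝ)⁻¹ * (orbitAvg (F n) (φ k) y + k *
          (((∑ e ∈ E, (((F n).image (e * ·)) ∆ (F n)).card : ℕ) : ℝ) / (F n).card)) := by
          rw [add_div, mul_div_assoc]
          rfl
      _ ≤ _ := by
          refine mul_le_mul_of_nonneg_left ?_ (by positivity)
          linarith
  refine hmain.trans ?_
  rw [mul_add]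
  nlinarith

end ReducedFamily

section ReducedLimit

theorem aemeasurable_ofReal_neg_mul {Y : Type*} [MeasurableSpace Y] {ν : Measure Y} {f : Y → ℝ}
    (hf : Integrable f ν) (c : ℝ) : AEMeasurable (fun y => ENNReal.ofReal (-(c * f y))) ν :=
  (hf.const_mul c).neg.aemeasurable.ennreal_ofReal

theorem aemeasurable_liminf {Y : Type*} [MeasurableSpace Y] {ν : Measure Y} {c : ℕ → Y → ℝ≥0∞}
    (hc : ∀ n, AEMeasurable (c n) ν) : AEMeasurable (fun y => liminf (fun n => c n y) atTop) ν := by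
  refine ⟨fun y => liminf (fun n => (hc n).mk _ y) atTop,
    Measurable.liminf fun n => (hc n).measurable_mk, ?_⟩
  filter_upwards [ae_all_iff.2 fun n => (hc n).ae_eq_mk] with y hy
  simp only [hy]

variable {G : Type*} [Group G] {Y : Type*} [MulAction G Y] [MeasurableSpace Y]
  {ν : Measure Y}

theorem ae_condExp_nonpos [IsProbabilityMeasure ν] {f : Y → ℝ} (hf : Integrable f ν)
    (hf0 : ∀ᵐ y ∂ν, f y ≤ 0) : ∀ᵐ y ∂ν, (ν[f | invSigma G ν]) y ≤ 0 := by
  have h0 : f ≤ᵐ[ν] fun _ => (0 : ℝ) := hf0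
  filter_upwards [condExp_mono (m := invSigma G ν) hf (integrable_const (0 : ℝ)) h0] with y hy
  simpa [condExp_const invSigma_le] using hy

theorem setLIntegral_ofReal_neg_condExp [IsProbabilityMeasure ν] {f : Y → ℝ}
    (hf : Integrable f ν) (hf0 : ∀ᵐ y ∂ν, f y ≤ 0) {c : ℝ} (hc : 0 ≤ c) {D : Set Y}
    (hD : MeasurableSet[invSigma G ν] D) :
    ∫⁻ y in D, ENNReal.ofReal (-(c * f y)) ∂ν
        = ∫⁻ y in D, ENNReal.ofReal (-(c * (ν[f | invSigma G ν]) y)) ∂ν := by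
  have key : ∀ h : Y → ℝ, Integrable h ν → (∀ᵐ y ∂ν, h y ≤ 0) →
      ∫⁻ y in D, ENNReal.ofReal (-(c * h y)) ∂ν = ENNReal.ofReal (-(c * ∫ y in D, h y ∂ν)) := by
    intro h hh hh0
    rw [← integral_const_mul, ← integral_neg]
    refine (ofReal_integral_eq_lintegral_ofReal (hh.const_mul c).neg.integrableOn ?_).symm
    filter_upwards [ae_restrict_of_ae hh0] with y hy
    simpa using mul_nonpos_of_nonneg_of_nonpos hc hy
  rw [key f hf hf0, key _ integrable_condExp (ae_condExp_nonpos hf hf0),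
    setIntegral_condExp invSigma_le hf hD]

/-- The negative of the infimum of the normalized conditional expectations of a family of
non-positive functions. -/
noncomputable def negInfCondExp (G : Type*) [Group G] {Y : Type*} [MulAction G Y]
    [MeasurableSpace Y] (ν : Measure Y) (a : Finset G → Y → ℝ) (y : Y) : ℝ≥0∞ :=
  ⨆ E ∈ {E : Finset G | E.Nonempty},
    ENNReal.ofReal (-((E.card : ℝ)⁻¹ * (ν[a E | invSigma G ν]) y))

theorem measurable_negInfCondExp [Countable G] (a : Finset G → Y → ℝ) :
    Measurable[invSigma G ν] (negInfCondExp G ν a) := by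
  refine Measurable.biSup _ (Set.to_countable _) fun E _ => ?_
  exact ENNReal.measurable_ofReal.comp
    (stronglyMeasurable_condExp.measurable.const_mul (E.card : ℝ)⁻¹).neg

variable [DecidableEq G] [IsProbabilityMeasure ν] {F : ℕ → Finset G} {a : Finset G → Y → ℝ}

theorem setLIntegral_liminf_le (hF : IsFolner F)
    (hint : ∀ E, Integrable (a E) ν) (ha : ∀ᵐ y ∂ν, IsReducedAt a y) {D : Set Y}
    (hD : MeasurableSet[invSigma G ν] D) :
    ∫⁻ y in D, liminf (fun n => ENNReal.ofReal (-(((F n).card : ℝ)⁻¹ * a (F n) y))) atTop ∂ν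
      ≤ ∫⁻ y in D, negInfCondExp G ν a y ∂ν := by
  refine (lintegral_liminf_le' fun n =>
    (aemeasurable_ofReal_neg_mul (hint (F n)) _).restrict).trans ?_
  refine liminf_le_of_le (by isBoundedDefault) fun b hb => ?_
  obtain ⟨n, hn⟩ := hb.exists
  refine hn.trans ?_
  rw [setLIntegral_ofReal_neg_condExp (hint _) (ha.mono fun y hy => hy.nonpos _)
    (by positivity) hD]
  exact lintegral_mono fun y => le_iSup₂ (f := fun (E : Finset G)
    (_ : E ∈ {E : Finset G | E.Nonempty}) =>
      ENNReal.ofReal (-((E.card : ℝ)⁻¹ * (ν[a E | invSigma G ν]) y))) (F n) (hF.1 n)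

variable [Countable G]

theorem ae_negInfCondExp_le_liminf
    (hact : ∀ g : G, MeasurePreserving (fun y : Y => g • y) ν ν)
    (hF : IsFolner F) (htemp : IsTempered F)
    (hint : ∀ E, Integrable (a E) ν) (ha : ∀ᵐ y ∂ν, IsReducedAt a y) :
    ∀ᵐ y ∂ν, negInfCondExp G ν a y
      ≤ liminf (fun n => ENNReal.ofReal (-(((F n).card : ℝ)⁻¹ * a (F n) y))) atTop := by
  have h : ∀ E : Finset G, ∀ᵐ y ∂ν, E.Nonempty → ∀ ε : ℝ, 0 < ε → ∀ᶠ n in atTop,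
      ((F n).card : ℝ)⁻¹ * a (F n) y ≤ (E.card : ℝ)⁻¹ * (ν[a E | invSigma G ν]) y + ε := by
    intro E
    by_cases hE : E.Nonempty
    · filter_upwards [ae_eventually_reduced_le hact hF htemp hint ha hE] with y hy _ using hy
    · exact ae_of_all _ fun y hE' => absurd hE' hE
  filter_upwards [ae_all_iff.2 h] with y hy
  refine iSup₂_le fun E hE => ?_
  have hlim : Tendsto (fun k : ℕ => ENNReal.ofReal
      (-((E.card : ℝ)⁻¹ * (ν[a E | invSigma G ν]) y) - 1 / ((k : ℝ) + 1))) atTop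
      (𝓝 (ENNReal.ofReal (-((E.card : ℝ)⁻¹ * (ν[a E | invSigma G ν]) y) - 0))) :=
    (ENNReal.continuous_ofReal.tendsto _).comp
      (tendsto_one_div_add_atTop_nhds_zero_nat.const_sub _)
  rw [sub_zero] at hlim
  refine le_of_tendsto' hlim fun k => le_liminf_of_le (by isBoundedDefault) ?_
  filter_upwards [hy E hE (1 / ((k : ℝ) + 1)) (by positivity)] with n hn
  exact ENNReal.ofReal_le_ofReal (by linarith)

theorem ae_liminf_eq_negInfCondExp
    (hact : ∀ g : G, MeasurePreserving (fun y : Y => g • y) ν ν)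
    (hF : IsFolner F) (htemp : IsTempered F)
    (hint : ∀ E, Integrable (a E) ν) (ha : ∀ᵐ y ∂ν, IsReducedAt a y) :
    ∀ᵐ y ∂ν, liminf (fun n => ENNReal.ofReal (-(((F n).card : ℝ)⁻¹ * a (F n) y))) atTop
      = negInfCondExp G ν a y := by
  have hle := ae_negInfCondExp_le_liminf hact hF htemp hint ha
  have hD : ∀ k : ℕ, ∀ᵐ y ∂ν, negInfCondExp G ν a y ≤ k →
      negInfCondExp G ν a y
        = liminf (fun n => ENNReal.ofReal (-(((F n).card : ℝ)⁻¹ * a (F n) y))) atTop := by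
    intro k
    have hDk : MeasurableSet[invSigma G ν] {y | negInfCondExp G ν a y ≤ k} :=
      measurable_negInfCondExp a measurableSet_Iic
    refine (ae_restrict_iff' (invSigma_le _ hDk)).1 ?_
    refine ae_eq_of_ae_le_of_lintegral_le (ae_restrict_of_ae hle) ?_
      (aemeasurable_liminf fun n => (aemeasurable_ofReal_neg_mul (hint (F n)) _).restrict)
      (setLIntegral_liminf_le hF hint ha hDk)
    refine ((setLIntegral_mono (s := {y | negInfCondExp G ν a y ≤ k}) (g := fun _ => (k : ℝ≥0∞))
      measurable_const fun y hy => hy).trans_lt ?_).ne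
    rw [setLIntegral_const]
    exact ENNReal.mul_lt_top (ENNReal.natCast_lt_top k) (measure_lt_top _ _)
  filter_upwards [hle, ae_all_iff.2 hD] with y h1 h2
  rcases eq_or_ne (negInfCondExp G ν a y) ⊤ with h | h
  · rw [h, top_le_iff] at h1
    rw [h1, h]
  · obtain ⟨k, hk⟩ := ENNReal.exists_nat_gt h
    exact (h2 k hk.le).symm

theorem lintegral_negInfCondExp
    (hact : ∀ g : G, MeasurePreserving (fun y : Y => g • y) ν ν)
    (hF : IsFolner F) (htemp : IsTempered F)
    (hint : ∀ E, Integrable (a E) ν) (ha : ∀ᵐ y ∂ν, IsReducedAt a y) :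
    ∫⁻ y, negInfCondExp G ν a y ∂ν = ⨆ E ∈ {E : Finset G | E.Nonempty},
      ENNReal.ofReal (-((E.card : ℝ)⁻¹ * ∫ y, a E y ∂ν)) := by
  have hE : ∀ E : Finset G, ENNReal.ofReal (-((E.card : ℝ)⁻¹ * ∫ y, a E y ∂ν))
      = ∫⁻ y, ENNReal.ofReal (-((E.card : ℝ)⁻¹ * a E y)) ∂ν := by
    intro E
    rw [← integral_const_mul, ← integral_neg]
    refine ofReal_integral_eq_lintegral_ofReal ((hint E).const_mul _).neg ?_
    filter_upwards [ha] with y hy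
    simpa using mul_nonpos_of_nonneg_of_nonpos (by positivity) (hy.nonpos E)
  refine le_antisymm ?_ (iSup₂_le fun E hEne => ?_)
  · refine (lintegral_mono_ae (ae_negInfCondExp_le_liminf hact hF htemp hint ha)).trans ?_
    refine (lintegral_liminf_le' fun n => aemeasurable_ofReal_neg_mul (hint (F n)) _).trans ?_
    refine liminf_le_of_le (by isBoundedDefault) fun b hb => ?_
    obtain ⟨n, hn⟩ := hb.exists
    refine hn.trans ?_
    rw [← hE]
    exact le_iSup₂ (f := fun (E : Finset G) (_ : E ∈ {E : Finset G | E.Nonempty}) =>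
      ENNReal.ofReal (-((E.card : ℝ)⁻¹ * ∫ y, a E y ∂ν))) (F n) (hF.1 n)
  · have hu := setLIntegral_ofReal_neg_condExp (G := G) (hint E)
      (ha.mono fun y hy => hy.nonpos _) (c := (E.card : ℝ)⁻¹) (by positivity)
      (D := Set.univ) MeasurableSet.univ
    rw [setLIntegral_univ, setLIntegral_univ] at hu
    rw [hE, hu]
    exact lintegral_mono fun y => le_iSup₂ (f := fun (E : Finset G)
      (_ : E ∈ {E : Finset G | E.Nonempty}) =>
        ENNReal.ofReal (-((E.card : ℝ)⁻¹ * (ν[a E | invSigma G ν]) y))) E hEne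

end ReducedLimit

section ERealFacts

theorem antitone_coe_sub_coe (x : ℝ) : Antitone fun z : ℝ≥0∞ => (x : EReal) - (z : EReal) :=
  fun _ _ h => EReal.sub_le_sub le_rfl (by exact_mod_cast h)

theorem continuous_coe_sub_coe (x : ℝ) : Continuous fun z : ℝ≥0∞ => (x : EReal) - (z : EReal) := by
  refine continuous_iff_continuousAt.2 fun z => ?_
  have h1 : ContinuousAt (fun p : EReal × EReal => p.1 + p.2) ((x : EReal), -(z : EReal)) :=
    EReal.continuousAt_add (Or.inl (EReal.coe_ne_top x)) (Or.inl (EReal.coe_ne_bot x))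
  have h2 : ContinuousAt (fun z : ℝ≥0∞ => ((x : EReal), -(z : EReal))) z :=
    (continuous_const.prodMk (continuous_neg.comp continuous_coe_ennreal_ereal)).continuousAt
  exact ContinuousAt.comp (f := fun z : ℝ≥0∞ => ((x : EReal), -(z : EReal))) h1 h2

theorem coe_sub_coe_ofReal (x : ℝ) {c : ℝ} (hc : 0 ≤ c) :
    (x : EReal) - (ENNReal.ofReal c : EReal) = ((x - c : ℝ) : EReal) := by
  rw [EReal.coe_ennreal_ofReal, max_eq_left hc, EReal.coe_sub]

theorem biInf_coe_sub_eq {ι : Type*} {S : Set ι} (hS : S.Nonempty) (x : ℝ) {e : ι → ℝ}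
    (he : ∀ i ∈ S, 0 ≤ e i) :
    ⨅ i ∈ S, ((x - e i : ℝ) : EReal)
      = (x : EReal) - ((⨆ i ∈ S, ENNReal.ofReal (e i) : ℝ≥0∞) : EReal) := by
  have : Nonempty S := hS.to_subtype
  rw [iInf_subtype', iSup_subtype']
  have h := Antitone.map_ciSup_of_continuousAt (f := fun z : ℝ≥0∞ => (x : EReal) - (z : EReal))
    (g := fun i : S => ENNReal.ofReal (e i)) (continuous_coe_sub_coe x).continuousAt
    (antitone_coe_sub_coe x)
  rw [h]
  exact iInf_congr fun i => (coe_sub_coe_ofReal x (he i i.2)).symm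

theorem limsup_coe_le_of_tendsto_sub {s t : ℕ → ℝ}
    (h : Tendsto (fun n => s n - t n) atTop (𝓝 0)) :
    limsup (fun n => (s n : EReal)) atTop ≤ limsup (fun n => (t n : EReal)) atTop := by
  have h0 : limsup (fun n => ((s n - t n : ℝ) : EReal)) atTop = 0 :=
    ((continuous_coe_real_ereal.tendsto 0).comp h).limsup_eq
  have := EReal.limsup_add_le (f := atTop) (u := fun n => ((s n - t n : ℝ) : EReal))
    (v := fun n => (t n : EReal)) (Or.inl (by rw [h0]; exact EReal.zero_ne_bot))
    (Or.inl (by rw [h0]; exact EReal.zero_ne_top))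
  rw [h0, zero_add] at this
  refine le_trans (le_of_eq ?_) this
  congr 1
  ext n
  rw [Pi.add_apply, ← EReal.coe_add, sub_add_cancel]

theorem limsup_coe_sub_eq {s c : ℕ → ℝ} {x : ℝ} (hs : Tendsto s atTop (𝓝 x))
    (hc : ∀ n, 0 ≤ c n) :
    limsup (fun n => ((s n - c n : ℝ) : EReal)) atTop
      = (x : EReal) - ((liminf (fun n => ENNReal.ofReal (c n)) atTop : ℝ≥0∞) : EReal) := by
  have h1 : limsup (fun n => ((s n - c n : ℝ) : EReal)) atTop
      = limsup (fun n => ((x - c n : ℝ) : EReal)) atTop := by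
    refine le_antisymm (limsup_coe_le_of_tendsto_sub ?_) (limsup_coe_le_of_tendsto_sub ?_)
    · simpa using hs.sub_const x
    · simpa using hs.const_sub x
  have h2 := Antitone.map_liminf_of_continuousAt (F := atTop) (antitone_coe_sub_coe x)
    (fun n => ENNReal.ofReal (c n)) (continuous_coe_sub_coe x).continuousAt
  rw [h1, h2]
  congr 1
  ext n
  exact (coe_sub_coe_ofReal x (hc n)).symm

theorem erealPosPart_coe (x : ℝ) : erealPosPart (x : EReal) = ENNReal.ofReal x := by
  simp [erealPosPart]

theorem erealPosPart_sub_add (x : ℝ) (v : ℝ≥0∞) :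
    erealPosPart ((x : EReal) - (v : EReal)) + v + ENNReal.ofReal (-x)
      = erealPosPart (-((x : EReal) - (v : EReal))) + ENNReal.ofReal x := by
  induction v with
  | top => simp [erealPosPart]
  | coe r =>
    have h : (x : EReal) - ((r : ℝ≥0∞) : EReal) = ((x - r : ℝ) : EReal) := by
      rw [EReal.coe_sub]
      rfl
    rw [h, ← EReal.coe_neg, erealPosPart_coe, erealPosPart_coe]
    rw [← ENNReal.toReal_eq_toReal_iff' (by finiteness) (by finiteness)]
    rw [ENNReal.toReal_add (by finiteness) (by finiteness),
      ENNReal.toReal_add (by finiteness) (by finiteness),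
      ENNReal.toReal_add (by finiteness) (by finiteness)]
    simp only [ENNReal.toReal_ofReal', ENNReal.coe_toReal]
    have h1 := max_zero_sub_max_neg_zero_eq_self (x - r)
    have h2 := max_zero_sub_max_neg_zero_eq_self x
    linarith

theorem erealPosPart_sub_le (x : ℝ) (v : ℝ≥0∞) :
    erealPosPart ((x : EReal) - (v : EReal)) ≤ ENNReal.ofReal x := by
  induction v with
  | top => simp [erealPosPart]
  | coe r =>
    have h : (x : EReal) - ((r : ℝ≥0∞) : EReal) = ((x - r : ℝ) : EReal) := by
      rw [EReal.coe_sub]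
      rfl
    rw [h, erealPosPart_coe]
    exact ENNReal.ofReal_le_ofReal (by linarith [r.2])

theorem erealIntegral_coe_sub {Y : Type*} [MeasurableSpace Y] {ν : Measure Y} {x : Y → ℝ}
    (hx : Integrable x ν) {v : Y → ℝ≥0∞} (hv : AEMeasurable v ν) :
    erealIntegral ν (fun y => (x y : EReal) - (v y : EReal))
      = ((∫ y, x y ∂ν : ℝ) : EReal) - ((∫⁻ y, v y ∂ν : ℝ≥0∞) : EReal) := by
  have hxm : AEMeasurable (fun y => ENNReal.ofReal (x y)) ν := hx.aemeasurable.ennreal_ofReal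
  have hxm' : AEMeasurable (fun y => ENNReal.ofReal (-x y)) ν :=
    hx.neg.aemeasurable.ennreal_ofReal
  have hX : ∫⁻ y, ENNReal.ofReal (x y) ∂ν ≠ ⊤ := hx.lintegral_lt_top.ne
  have hX' : ∫⁻ y, ENNReal.ofReal (-x y) ∂ν ≠ ⊤ := hx.neg.lintegral_lt_top.ne
  have hsum := lintegral_congr (μ := ν) fun y => erealPosPart_sub_add (x y) (v y)
  rw [lintegral_add_right' _ hxm', lintegral_add_right' _ hv, lintegral_add_right' _ hxm] at hsum
  have hP : ∫⁻ y, erealPosPart ((x y : EReal) - (v y : EReal)) ∂ν ≠ ⊤ :=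
    ((lintegral_mono fun y => erealPosPart_sub_le (x y) (v y)).trans_lt hX.lt_top).ne
  rw [erealIntegral, integral_eq_lintegral_pos_part_sub_lintegral_neg_part hx]
  generalize ∫⁻ y, ENNReal.ofReal (x y) ∂ν = X at *
  generalize ∫⁻ y, ENNReal.ofReal (-x y) ∂ν = X' at *
  generalize ∫⁻ y, erealPosPart ((x y : EReal) - (v y : EReal)) ∂ν = P at *
  generalize ∫⁻ y, erealPosPart (-((x y : EReal) - (v y : EReal))) ∂ν = N at *
  generalize ∫⁻ y, v y ∂ν = V at *
  lift X to NNReal using hX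
  lift X' to NNReal using hX'
  lift P to NNReal using hP
  induction V with
  | top =>
    have hN : N = ⊤ := by
      by_contra hN
      lift N to NNReal using hN
      have h : (N : ℝ≥0∞) + X ≠ ⊤ := by finiteness
      exact h (by simpa using hsum.symm)
    rw [hN, EReal.coe_ennreal_top, sub_eq_add_neg, sub_eq_add_neg, EReal.neg_top, EReal.add_bot,
      EReal.add_bot]
  | coe V =>
    have hN : N ≠ ⊤ := by
      rintro rfl
      simp at hsum
    lift N to NNReal using hN
    have h : P + V + X' = N + X := by exact_mod_cast hsum
    have h' : (P : ℝ) + V + X' = N + X := by exact_mod_cast h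
    change (((P : ℝ) : EReal)) - ((N : ℝ) : EReal)
      = (((X : ℝ) - (X' : ℝ) : ℝ) : EReal) - ((V : ℝ) : EReal)
    rw [← EReal.coe_sub, ← EReal.coe_sub]
    congr 1
    linarith

end ERealFacts

section Reduction

variable {G : Type*} [Group G] {Y : Type*} [MulAction G Y]

/-- The family obtained from `d` by subtracting the additive family with the same values on
singletons. -/
def reducedFamily (d : Finset G → Y → ℝ) (E : Finset G) (y : Y) : ℝ :=
  d E y - ∑ g ∈ E, d {1} (g • y)

theorem div_card_eq_orbitAvg_sub (d : Finset G → Y → ℝ) (E : Finset G) (y : Y) :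
    d E y / (E.card : ℝ)
      = orbitAvg E (d {1}) y - -((E.card : ℝ)⁻¹ * reducedFamily d E y) := by
  rw [orbitAvg, reducedFamily]
  ring

variable [MeasurableSpace Y] {ν : Measure Y} {d : Finset G → Y → ℝ}

theorem ae_isReducedAt_reducedFamily [Countable G] [DecidableEq G]
    (hd0 : ∀ y, d ∅ y = 0)
    (hinv : ∀ F : Finset G, F.Nonempty → ∀ g : G,
      ∀ᵐ y ∂ν, d (F.image (· * g)) y = d F (g • y))
    (hstrong : ∀ E F : Finset G,
      ∀ᵐ y ∂ν, d (E ∩ F) y + d (E ∪ F) y ≤ d E y + d F y) :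
    ∀ᵐ y ∂ν, IsReducedAt (reducedFamily d) y := by
  have hinv' : ∀ (F : Finset G) (g : G), ∀ᵐ y ∂ν, d (F.image (· * g)) y = d F (g • y) := by
    intro F g
    rcases F.eq_empty_or_nonempty with rfl | hF
    · simp [hd0]
    · exact hinv F hF g
  filter_upwards [ae_all_iff.2 fun E => ae_all_iff.2 (hstrong E),
    ae_all_iff.2 fun E => ae_all_iff.2 (hinv' E)] with y hs hi
  refine ⟨by simp [reducedFamily, hd0], fun A B => ?_, fun g => ?_, fun E g => ?_⟩
  · have h := Finset.sum_union_inter (s₁ := A) (s₂ := B) (f := fun g => d {1} (g • y))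
    simp only [reducedFamily]
    linarith [hs A B]
  · have h := hi {1} g
    rw [Finset.image_singleton, one_mul] at h
    simp [reducedFamily, h]
  · rw [reducedFamily, reducedFamily, hi E g,
      Finset.sum_image fun a _ b _ hab => mul_right_cancel hab]
    simp only [mul_smul]

theorem integrable_sum_comp_smul
    (hact : ∀ g : G, MeasurePreserving (fun y : Y => g • y) ν ν)
    (hint : ∀ E : Finset G, E.Nonempty → Integrable (d E) ν) (E : Finset G) :
    Integrable (fun y => ∑ g ∈ E, d {1} (g • y)) ν :=
  integrable_finsetSum _ fun g _ =>
    (hact g).integrable_comp_of_integrable (hint {1} (Finset.singleton_nonempty 1))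

theorem integrable_reducedFamily
    (hact : ∀ g : G, MeasurePreserving (fun y : Y => g • y) ν ν)
    (hint : ∀ E : Finset G, E.Nonempty → Integrable (d E) ν)
    (hd0 : ∀ y, d ∅ y = 0) (E : Finset G) :
    Integrable (reducedFamily d E) ν := by
  refine Integrable.sub ?_ (integrable_sum_comp_smul hact hint E)
  rcases E.eq_empty_or_nonempty with rfl | hE
  · rw [show d ∅ = fun _ => (0 : ℝ) from funext hd0]
    exact integrable_zero _ _ _
  · exact hint E hE

theorem inv_card_mul_condExp_eq [IsProbabilityMeasure ν]
    (hact : ∀ g : G, MeasurePreserving (fun y : Y => g • y) ν ν)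
    (hint : ∀ E : Finset G, E.Nonempty → Integrable (d E) ν)
    {E : Finset G} (hE : E.Nonempty) :
    ∀ᵐ y ∂ν, (E.card : ℝ)⁻¹ * (ν[d E | invSigma G ν]) y
      = (ν[d {1} | invSigma G ν]) y
        - -((E.card : ℝ)⁻¹ * (ν[reducedFamily d E | invSigma G ν]) y) := by
  have h1 := hint {1} (Finset.singleton_nonempty 1)
  have hsub : ν[reducedFamily d E | invSigma G ν] =ᵐ[ν]
      ν[d E | invSigma G ν] - ν[fun y => ∑ g ∈ E, d {1} (g • y) | invSigma G ν] :=
    condExp_sub (hint E hE) (integrable_sum_comp_smul hact hint E) (invSigma G ν)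
  have hsum : ν[fun y => ∑ g ∈ E, d {1} (g • y) | invSigma G ν]
      =ᵐ[ν] ∑ g ∈ E, ν[fun y => d {1} (g • y) | invSigma G ν] := by
    have := condExp_finsetSum (μ := ν) (s := E) (f := fun g y => d {1} (g • y))
      (fun g _ => (hact g).integrable_comp_of_integrable h1) (invSigma G ν)
    rwa [show (∑ g ∈ E, fun y => d {1} (g • y)) = fun y => ∑ g ∈ E, d {1} (g • y) from
      funext fun y => Finset.sum_apply y E _] at this
  have hg : ∀ᵐ y ∂ν, ∀ g ∈ E, (ν[fun y => d {1} (g • y) | invSigma G ν]) y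
      = (ν[d {1} | invSigma G ν]) y :=
    (Finset.eventually_all E).2 fun g _ => condExp_of_comp_smul hact h1 g
  filter_upwards [hsub, hsum, hg] with y hy1 hy2 hy3
  have hc : (E.card : ℝ) ≠ 0 := by exact_mod_cast hE.card_pos.ne'
  rw [hy1, Pi.sub_apply, hy2, Finset.sum_apply, Finset.sum_congr rfl hy3, Finset.sum_const,
    nsmul_eq_mul]
  field_simp
  ring

theorem inv_card_mul_integral_eq
    (hact : ∀ g : G, MeasurePreserving (fun y : Y => g • y) ν ν)
    (hint : ∀ E : Finset G, E.Nonempty → Integrable (d E) ν)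
    {E : Finset G} (hE : E.Nonempty) :
    (E.card : ℝ)⁻¹ * ∫ y, d E y ∂ν
      = ∫ y, d {1} y ∂ν - -((E.card : ℝ)⁻¹ * ∫ y, reducedFamily d E y ∂ν) := by
  have h1 := hint {1} (Finset.singleton_nonempty 1)
  have hc : (E.card : ℝ) ≠ 0 := by exact_mod_cast hE.card_pos.ne'
  have h : ∫ y, reducedFamily d E y ∂ν = ∫ y, d E y ∂ν - (E.card : ℝ) * ∫ y, d {1} y ∂ν := by
    unfold reducedFamily
    rw [integral_sub (hint E hE) (integrable_sum_comp_smul hact hint E),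
      integral_finsetSum (f := fun g y => d {1} (g • y)) _
        fun g _ => (hact g).integrable_comp_of_integrable h1,
      Finset.sum_congr rfl fun g _ => integral_comp_smul hact h1.aestronglyMeasurable g,
      Finset.sum_const, nsmul_eq_mul]
  rw [h]
  field_simp
  ring

theorem ae_iInf_condExp_eq [Countable G] [DecidableEq G] [IsProbabilityMeasure ν]
    (hact : ∀ g : G, MeasurePreserving (fun y : Y => g • y) ν ν)
    (hint : ∀ E : Finset G, E.Nonempty → Integrable (d E) ν)
    (hd0 : ∀ y, d ∅ y = 0) (ha : ∀ᵐ y ∂ν, IsReducedAt (reducedFamily d) y) :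
    ∀ᵐ y ∂ν, ⨅ E ∈ {E : Finset G | E.Nonempty},
        (((E.card : ℝ)⁻¹ * (ν[d E | invSigma G ν]) y : ℝ) : EReal)
      = ((ν[d {1} | invSigma G ν]) y : EReal)
        - (negInfCondExp G ν (reducedFamily d) y : EReal) := by
  have h1 : ∀ E : Finset G, ∀ᵐ y ∂ν, E.Nonempty → (E.card : ℝ)⁻¹ * (ν[d E | invSigma G ν]) y
      = (ν[d {1} | invSigma G ν]) y
        - -((E.card : ℝ)⁻¹ * (ν[reducedFamily d E | invSigma G ν]) y) := by
    intro E
    by_cases hE : E.Nonempty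
    · filter_upwards [inv_card_mul_condExp_eq hact hint hE] with y hy _ using hy
    · exact ae_of_all _ fun y hE' => absurd hE' hE
  have h2 : ∀ E : Finset G, ∀ᵐ y ∂ν, (ν[reducedFamily d E | invSigma G ν]) y ≤ 0 := fun E =>
    ae_condExp_nonpos (integrable_reducedFamily hact hint hd0 E) (ha.mono fun y hy => hy.nonpos E)
  filter_upwards [ae_all_iff.2 h1, ae_all_iff.2 h2] with y hy1 hy2
  rw [negInfCondExp, ← biInf_coe_sub_eq ⟨{1}, Finset.singleton_nonempty 1⟩]
  · exact iInf_congr fun E => iInf_congr fun hE => by rw [hy1 E hE]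
  · exact fun E _ => neg_nonneg.2 (mul_nonpos_of_nonneg_of_nonpos (by positivity) (hy2 E))

end Reduction

/-- Theorem 4.2 of the paper: for a strongly sub-additive `G`-invariant family `𝐃 ⊆ L¹(ν)`
and a tempered Følner sequence, `limsup_n d_{F_n}(y)/|F_n| = inf_{F ∈ 𝓕_G} (1/|F|)E(d_F|𝓘)(y)`
a.e.; this function is `G`-invariant and measurable, and its integral equals
`ν(𝐃) = inf_{F ∈ 𝓕_G} (1/|F|) ∫ d_F dν`. -/
theorem limsup_strongly_subadditive
    {G : Type*} [Group G] [Countable G] [Infinite G] [DecidableEq G]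
    {Y : Type*} [MeasurableSpace Y] [MulAction G Y]
    (ν : Measure Y) [IsProbabilityMeasure ν]
    (hact : ∀ g : G, MeasurePreserving (fun y => g • y) ν ν)
    (d : Finset G → Y → ℝ)
    (hint : ∀ F : Finset G, F.Nonempty → Integrable (d F) ν)
    (hd0 : ∀ y, d ∅ y = 0)
    (hinv : ∀ F : Finset G, F.Nonempty → ∀ g : G,
      ∀ᵐ y ∂ν, d (F.image (· * g)) y = d F (g • y))
    (hstrong : ∀ E F : Finset G,
      ∀ᵐ y ∂ν, d (E ∩ F) y + d (E ∪ F) y ≤ d E y + d F y)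
    (F : ℕ → Finset G) (hF : IsFolner F) (htemp : IsTempered F) :
    (∀ᵐ y ∂ν,
        limsup (fun n => ((d (F n) y / ((F n).card : ℝ) : ℝ) : EReal)) atTop
          = ⨅ E ∈ {E : Finset G | E.Nonempty},
              (((E.card : ℝ)⁻¹ * (ν[d E | invSigma G ν]) y : ℝ) : EReal)) ∧
    Measurable (fun y => ⨅ E ∈ {E : Finset G | E.Nonempty},
        (((E.card : ℝ)⁻¹ * (ν[d E | invSigma G ν]) y : ℝ) : EReal)) ∧
    (∀ g : G, ∀ᵐ y ∂ν,
        (⨅ E ∈ {E : Finset G | E.Nonempty},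
            (((E.card : ℝ)⁻¹ * (ν[d E | invSigma G ν]) (g • y) : ℝ) : EReal))
          = ⨅ E ∈ {E : Finset G | E.Nonempty},
              (((E.card : ℝ)⁻¹ * (ν[d E | invSigma G ν]) y : ℝ) : EReal)) ∧
    erealIntegral ν (fun y => ⨅ E ∈ {E : Finset G | E.Nonempty},
        (((E.card : ℝ)⁻¹ * (ν[d E | invSigma G ν]) y : ℝ) : EReal))
      = ⨅ E ∈ {E : Finset G | E.Nonempty},
          (((E.card : ℝ)⁻¹ * ∫ y, d E y ∂ν : ℝ) : EReal) := by
  have ha := ae_isReducedAt_reducedFamily hd0 hinv hstrong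
  have hint' := integrable_reducedFamily hact hint hd0
  have h1 := hint {1} (Finset.singleton_nonempty 1)
  have hinf := ae_iInf_condExp_eq hact hint hd0 ha
  refine ⟨?_, ?_, fun g => ?_, ?_⟩
  · filter_upwards [ha, hinf, (avgTendstoCondExp hact hF htemp h1).2,
      ae_liminf_eq_negInfCondExp hact hF htemp hint' ha] with y hy hy1 hy2 hy3
    rw [hy1, ← hy3, ← limsup_coe_sub_eq hy2 fun n =>
      neg_nonneg.2 (mul_nonpos_of_nonneg_of_nonpos (by positivity) (hy.nonpos (F n)))]
    simp only [div_card_eq_orbitAvg_sub]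
  · refine Measurable.biInf _ (Set.to_countable _) fun E _ => measurable_coe_real_ereal.comp ?_
    exact (stronglyMeasurable_condExp.measurable.mono invSigma_le le_rfl).const_mul _
  · filter_upwards [ae_all_iff.2 fun E => condExp_comp_smul_ae_eq (ν := ν) (f := d E) g] with y hy
    simp only [hy]
  · have hcongr : erealIntegral ν (fun y => ⨅ E ∈ {E : Finset G | E.Nonempty},
          (((E.card : ℝ)⁻¹ * (ν[d E | invSigma G ν]) y : ℝ) : EReal))
        = erealIntegral ν (fun y => ((ν[d {1} | invSigma G ν]) y : EReal)
            - (negInfCondExp G ν (reducedFamily d) y : EReal)) := by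
      unfold erealIntegral
      congr 2 <;> refine lintegral_congr_ae (hinf.mono fun y hy => ?_) <;> simp only [hy]
    rw [hcongr, erealIntegral_coe_sub integrable_condExp
        ((measurable_negInfCondExp _).mono invSigma_le le_rfl).aemeasurable,
      integral_condExp invSigma_le, lintegral_negInfCondExp hact hF htemp hint' ha,
      ← biInf_coe_sub_eq ⟨{1}, Finset.singleton_nonempty 1⟩]
    · exact iInf_congr fun E => iInf_congr fun hE => by rw [inv_card_mul_integral_eq hact hint hE]
    · exact fun E _ => neg_nonneg.2 (mul_nonpos_of_nonneg_of_nonpos (by positivity)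
        (integral_nonpos_of_ae (ha.mono fun y hy => hy.nonpos E)))
end

section
/- Let {F_n : n ∈ ℕ} be a tempered Følner sequence of a countably infinite discrete group G, and assume ∅ ≠ E_n ⊆ F_n for each n with lim_{n→∞} |E_n|/|F_n| = 1. Then {E_n : n ∈ ℕ} is also a tempered Følner sequence of G. -/
open Filter Topology
open scoped symmDiff Pointwise

/-- Passing from `F` to a subset `E` changes `|gF ∆ F|` by at most `2|F \ E|`. -/
lemma card_image_mul_symmDiff_le_of_subset {G : Type*} [Group G] [DecidableEq G]
    {E F : Finset G} (h : E ⊆ F) (g : G) :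
    ((E.image (g * ·) ∆ E).card : ℝ) ≤
      ((F.image (g * ·) ∆ F).card : ℝ) + 2 * ((F.card : ℝ) - E.card) := by
  have hcover : E.image (g * ·) ∆ E ⊆
      (F.image (g * ·) ∆ F) ∪ ((F \ E).image (g * ·) ∪ (F \ E)) := by
    intro x
    simp only [Finset.mem_symmDiff, Finset.mem_union, Finset.mem_image, Finset.mem_sdiff]
    rintro (⟨⟨y, hy, rfl⟩, hx⟩ | ⟨hx, hy⟩)
    · by_cases hxF : g * y ∈ F
      · exact .inr (.inr ⟨hxF, hx⟩)
      · exact .inl (.inl ⟨⟨y, h hy, rfl⟩, hxF⟩)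
    · by_cases hz : ∃ z ∈ F, g * z = x
      · obtain ⟨z, hzF, rfl⟩ := hz
        exact .inr (.inl ⟨z, ⟨hzF, fun hzE => hy ⟨z, hzE, rfl⟩⟩, rfl⟩)
      · exact .inl (.inr ⟨h hx, hz⟩)
  have hle := (Finset.card_le_card hcover).trans ((Finset.card_union_le _ _).trans
    (Nat.add_le_add_left ((Finset.card_union_le _ _).trans
      (Nat.add_le_add_right Finset.card_image_le _)) _))
  have hadd := Finset.card_sdiff_add_card_eq_card h
  have hle' : ((E.image (g * ·) ∆ E).card : ℝ) ≤
      (F.image (g * ·) ∆ F).card + ((F \ E).card + (F \ E).card) := by exact_mod_cast hle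
  have hadd' : ((F \ E).card : ℝ) + E.card = F.card := by exact_mod_cast hadd
  linarith

/-- Lemma 4.3 of the paper: if `{F_n}` is a tempered Følner sequence of a countably infinite
discrete group `G` and `∅ ≠ E_n ⊆ F_n` with `|E_n|/|F_n| → 1`, then `{E_n}` is also a tempered
Følner sequence of `G`. -/
theorem tempered_folner_of_subsets
    {G : Type*} [Group G] [Countable G] [Infinite G] [DecidableEq G]
    (F E : ℕ → Finset G) (hF : IsFolner F) (hFtemp : IsTempered F)
    (hne : ∀ n, (E n).Nonempty) (hsub : ∀ n, E n ⊆ F n)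
    (hcard : Tendsto (fun n => ((E n).card : ℝ) / ((F n).card : ℝ)) atTop (𝓝 1)) :
    IsFolner E ∧ IsTempered E := by
  have hEpos : ∀ n, (0 : ℝ) < (E n).card := fun n => by exact_mod_cast (hne n).card_pos
  have hFpos : ∀ n, (0 : ℝ) < (F n).card := fun n => by exact_mod_cast (hF.1 n).card_pos
  refine ⟨⟨hne, fun g => ?_⟩, ?_⟩
  · have hlim := ((hF.2 g).add ((hcard.const_sub 1).const_mul 2)).div hcard one_ne_zero
    norm_num only at hlim
    refine squeeze_zero (fun n => by positivity) (fun n => ?_) hlim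
    have hE := hEpos n
    have hFn := hFpos n
    calc _ ≤ (((((F n).image (g * ·)) ∆ (F n)).card : ℝ)
          + 2 * ((F n).card - (E n).card)) / (E n).card := by
          gcongr
          exact card_image_mul_symmDiff_le_of_subset (hsub n) g
      _ = _ := by
          simp only [Pi.div_apply]
          field_simp
  · obtain ⟨M, hM, hbound⟩ := hFtemp
    obtain ⟨C, hC⟩ := (hcard.inv₀ one_ne_zero).bddAbove_range
    have hFE : ∀ n, ((F n).card : ℝ) ≤ C * (E n).card := fun n => by
      have hn := hC (Set.mem_range_self n)
      rwa [inv_div, div_le_iff₀ (hEpos n)] at hn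
    have hCpos : 0 < C := pos_of_mul_pos_left ((hFpos 0).trans_le (hFE 0)) (hEpos 0).le
    refine ⟨M * C, mul_pos hM hCpos, fun n => ?_⟩
    calc _ ≤ (((Finset.range (n + 1)).biUnion fun k => (F k)⁻¹ * F (n + 1)).card : ℝ) := by
          refine Nat.cast_le.mpr (Finset.card_le_card (Finset.biUnion_mono fun k _ => ?_))
          exact Finset.mul_subset_mul (Finset.inv_subset_inv (hsub k)) (hsub (n + 1))
      _ ≤ M * (F (n + 1)).card := hbound n
      _ ≤ M * (C * (E (n + 1)).card) := by
          gcongr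
          exact hFE (n + 1)
      _ = M * C * (E (n + 1)).card := by ring
end

section
/- Let (Y, 𝒟, ν, G) be an MDS, let 𝐃 = {d_F : F ∈ 𝓕_G} ⊆ L¹(Y, 𝒟, ν) be a sub-additive G-invariant family such that −𝐃 is non-negative and 𝐃 is G-bi-invariant, let {F_n : n ∈ ℕ} be a Følner sequence of G, let T ∈ 𝒯_G, and let ε > 0. Then for all sufficiently large n ∈ ℕ there exists H_n ⊆ F_n such that |F_n \ H_n| < 2ε|F_n| and, for ν-a.e. y ∈ Y, d_{F_n}(y) ≤ (1/|T|) Σ_{g ∈ H_n} d_T(gy). -/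
open MeasureTheory Filter Topology
open scoped symmDiff Pointwise

/-- A non-empty finite subset `T` tiles `G` if some family of right translates
`{T c : c ∈ C}` forms a partition of `G`. -/
def Tiles {G : Type*} [Group G] (T : Finset G) : Prop :=
  T.Nonempty ∧ ∃ C : Set G, ∀ x : G, ∃! c : G, c ∈ C ∧ ∃ t ∈ T, x = t * c

/-- A non-positive sub-additive family is a.e. bounded on `E` by the sum over any finite family of
disjoint non-empty subsets of `E`. -/
lemma ae_le_sum_of_subadditive {G Y ι : Type*} [DecidableEq G] [DecidableEq ι] [MeasurableSpace Y]
    (ν : Measure Y) (d : Finset G → Y → ℝ)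
    (hsub : ∀ E F : Finset G, E.Nonempty → F.Nonempty → Disjoint E F →
      ∀ᵐ y ∂ν, d (E ∪ F) y ≤ d E y + d F y)
    (hnonpos : ∀ F : Finset G, F.Nonempty → ∀ᵐ y ∂ν, d F y ≤ 0)
    (A : ι → Finset G) (hA : ∀ i, (A i).Nonempty) (S : Finset ι)
    (hdisj : ∀ i ∈ S, ∀ j ∈ S, i ≠ j → Disjoint (A i) (A j))
    (E : Finset G) (hE : E.Nonempty) (hAE : ∀ i ∈ S, A i ⊆ E) :
    ∀ᵐ y ∂ν, d E y ≤ ∑ i ∈ S, d (A i) y := by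
  induction S using Finset.induction_on generalizing E with
  | empty => simpa using hnonpos E hE
  | insert a S ha ih =>
    have haE : A a ⊆ E := hAE a (Finset.mem_insert_self a S)
    have hrest : ∀ i ∈ S, A i ⊆ E \ A a := fun i hi =>
      Finset.subset_sdiff.2 ⟨hAE i (Finset.mem_insert_of_mem hi),
        hdisj i (Finset.mem_insert_of_mem hi) a (Finset.mem_insert_self a S)
          (fun h => ha (h ▸ hi))⟩
    rcases (E \ A a).eq_empty_or_nonempty with h | h
    · have hS : S = ∅ := Finset.eq_empty_of_forall_notMem fun i hi => by
        have := (hA i).mono (hrest i hi)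
        simp [h] at this
      have hEA : E = A a := (Finset.sdiff_eq_empty_iff_subset.1 h).antisymm haE
      simp [hS, hEA]
    · filter_upwards [hsub (A a) (E \ A a) (hA a) h Finset.disjoint_sdiff,
        ih (fun i hi j hj => hdisj i (Finset.mem_insert_of_mem hi) j (Finset.mem_insert_of_mem hj))
          (E \ A a) h hrest] with y h1 h2
      rw [Finset.union_sdiff_of_subset haE] at h1
      rw [Finset.sum_insert ha]
      linarith

/-- The elements of a finite set moved out of it by a given finite set of left translations are
controlled by the symmetric differences with the translates. -/
lemma card_sdiff_filter_mul_mem_le {G : Type*} [Group G] [DecidableEq G] (K E : Finset G) :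
    (E \ {g ∈ E | ∀ k ∈ K, k * g ∈ E}).card ≤ ∑ k ∈ K, (E.image (k * ·) ∆ E).card := by
  have hsubset : E \ {g ∈ E | ∀ k ∈ K, k * g ∈ E} ⊆ K.biUnion fun k => {g ∈ E | k * g ∉ E} := by
    intro g hg
    simp only [Finset.mem_sdiff, Finset.mem_filter, not_and, not_forall] at hg
    obtain ⟨hgE, h⟩ := hg
    obtain ⟨k, hk, hkg⟩ := h hgE
    exact Finset.mem_biUnion.2 ⟨k, hk, Finset.mem_filter.2 ⟨hgE, hkg⟩⟩
  refine (Finset.card_le_card hsubset).trans (Finset.card_biUnion_le.trans ?_)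
  refine Finset.sum_le_sum fun k _ => ?_
  refine Finset.card_le_card_of_injOn (k * ·) (fun g hg => ?_) (mul_right_injective k).injOn
  have hg' := Finset.mem_filter.1 hg
  exact Finset.mem_coe.2 (Finset.mem_symmDiff.2
    (Or.inl ⟨Finset.mem_image_of_mem _ hg'.1, hg'.2⟩))

/-- Along a Følner sequence, almost all elements are kept inside by finitely many translations. -/
lemma IsFolner.eventually_card_sdiff_lt {G : Type*} [Group G] [DecidableEq G]
    {F : ℕ → Finset G} (hF : IsFolner F) (K : Finset G) {δ : ℝ} (hδ : 0 < δ) :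
    ∀ᶠ n in atTop,
      ((F n \ {g ∈ F n | ∀ k ∈ K, k * g ∈ F n}).card : ℝ) < δ * (F n).card := by
  have hlim := tendsto_finsetSum K fun k _ => hF.2 k
  rw [Finset.sum_const_zero] at hlim
  filter_upwards [hlim.eventually (gt_mem_nhds hδ)] with n hn
  have hpos : (0 : ℝ) < (F n).card := by exact_mod_cast (hF.1 n).card_pos
  rw [← Finset.sum_div, div_lt_iff₀ hpos] at hn
  refine lt_of_le_of_lt ?_ hn
  exact_mod_cast card_sdiff_filter_mul_mem_le K (F n)

/-- For a bi-invariant family, conjugating a set before translating it has no effect. -/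
lemma ae_image_conj_eq {G Y : Type*} [Group G] [DecidableEq G] [MeasurableSpace Y] [MulAction G Y]
    (ν : Measure Y) (hact : ∀ g : G, MeasurePreserving (fun y => g • y) ν ν)
    (d : Finset G → Y → ℝ)
    (hinv : ∀ F : Finset G, F.Nonempty → ∀ g : G,
      ∀ᵐ y ∂ν, d (F.image (· * g)) y = d F (g • y))
    (hbi : ∀ F : Finset G, F.Nonempty → ∀ g : G,
      ∀ᵐ y ∂ν, d (F.image (g * ·)) y = d (F.image (· * g)) y)
    (T : Finset G) (hT : T.Nonempty) (s g : G) :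
    ∀ᵐ y ∂ν, d (T.image fun t => s * t * (s⁻¹ * g)) y = d T (g • y) := by
  have hq := (hact (s⁻¹ * g)).quasiMeasurePreserving
  filter_upwards [hinv (T.image (s * ·)) (hT.image _) (s⁻¹ * g), hq.ae (hbi T hT s),
    hq.ae (hinv T hT s)] with y h1 h2 h3
  rw [Finset.image_image] at h1
  rw [show (fun t => s * t * (s⁻¹ * g)) = (· * (s⁻¹ * g)) ∘ (s * ·) from rfl, h1, h2, h3,
    smul_smul, mul_inv_cancel_left]

/-- Lemma 4.4 of the paper: let `𝐃 = {d_F} ⊆ L¹(ν)` be a sub-additive `G`-bi-invariant family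
with `-𝐃` non-negative, `{F_n}` a Følner sequence of `G`, `T ∈ 𝒯_G` and `ε > 0`. Then for all
sufficiently large `n` there exists `H_n ⊆ F_n` with `|F_n \ H_n| < 2ε|F_n|` and, for
`ν`-a.e. `y`, `d_{F_n}(y) ≤ (1/|T|) Σ_{g ∈ H_n} d_T(g y)`. -/
theorem subadditive_biinvariant_tile_bound
    {G : Type*} [Group G] [Countable G] [Infinite G] [DecidableEq G]
    {Y : Type*} [MeasurableSpace Y] [MulAction G Y]
    (ν : Measure Y) [IsProbabilityMeasure ν]
    (hact : ∀ g : G, MeasurePreserving (fun y => g • y) ν ν)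
    (d : Finset G → Y → ℝ)
    (hint : ∀ F : Finset G, F.Nonempty → Integrable (d F) ν)
    (hinv : ∀ F : Finset G, F.Nonempty → ∀ g : G,
      ∀ᵐ y ∂ν, d (F.image (· * g)) y = d F (g • y))
    (hbi : ∀ F : Finset G, F.Nonempty → ∀ g : G,
      ∀ᵐ y ∂ν, d (F.image (g * ·)) y = d (F.image (· * g)) y)
    (hsub : ∀ E F : Finset G, E.Nonempty → F.Nonempty → Disjoint E F →
      ∀ᵐ y ∂ν, d (E ∪ F) y ≤ d E y + d F y)
    (hnonpos : ∀ F : Finset G, F.Nonempty → ∀ᵐ y ∂ν, d F y ≤ 0)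
    (F : ℕ → Finset G) (hF : IsFolner F)
    (T : Finset G) (hT : Tiles T) (ε : ℝ) (hε : 0 < ε) :
    ∀ᶠ n in atTop, ∃ H ⊆ F n,
      (((F n \ H).card : ℝ) < 2 * ε * ((F n).card : ℝ)) ∧
      ∀ᵐ y ∂ν, d (F n) y ≤ (T.card : ℝ)⁻¹ * ∑ g ∈ H, d T (g • y) := by
  classical
  obtain ⟨hTne, C, hC⟩ := hT
  set K : Finset G := (T ×ˢ T).image fun p => p.1 * p.2 * p.1⁻¹ with hK
  filter_upwards [hF.eventually_card_sdiff_lt K (δ := 2 * ε) (by positivity)] with n hn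
  set H : Finset G := {g ∈ F n | ∀ k ∈ K, k * g ∈ F n} with hH
  refine ⟨H, Finset.filter_subset _ _, hn, ?_⟩
  have hdisj : ∀ s : G, ∀ g ∈ {g ∈ H | s⁻¹ * g ∈ C}, ∀ h ∈ {g ∈ H | s⁻¹ * g ∈ C}, g ≠ h →
      Disjoint (T.image fun t => s * t * (s⁻¹ * g)) (T.image fun t => s * t * (s⁻¹ * h)) := by
    intro s g hg h hh hne
    rw [Finset.disjoint_left]
    intro x hx hx'
    obtain ⟨t, ht, rfl⟩ := Finset.mem_image.1 hx
    obtain ⟨u, hu, hut⟩ := Finset.mem_image.1 hx'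
    rw [mul_assoc, mul_assoc s t] at hut
    have := (hC (t * (s⁻¹ * g))).unique ⟨(Finset.mem_filter.1 hg).2, t, ht, rfl⟩
      ⟨(Finset.mem_filter.1 hh).2, u, hu, (mul_left_cancel hut).symm⟩
    exact hne (mul_left_cancel this)
  have hle : ∀ s ∈ T, ∀ᵐ y ∂ν, d (F n) y ≤ ∑ g ∈ H with s⁻¹ * g ∈ C, d T (g • y) := by
    intro s hs
    have hconj : ∀ᵐ y ∂ν, ∀ g : G, d (T.image fun t => s * t * (s⁻¹ * g)) y = d T (g • y) :=
      ae_all_iff.2 fun g => ae_image_conj_eq ν hact d hinv hbi T hTne s g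
    filter_upwards [hconj, ae_le_sum_of_subadditive ν d hsub hnonpos
      (fun g => T.image fun t => s * t * (s⁻¹ * g)) (fun g => hTne.image _)
      {g ∈ H | s⁻¹ * g ∈ C} (hdisj s) (F n) (hF.1 n) (by
        intro g hg x hx
        obtain ⟨t, ht, rfl⟩ := Finset.mem_image.1 hx
        rw [← mul_assoc]
        exact (Finset.mem_filter.1 (Finset.mem_filter.1 hg).1).2 _
          (Finset.mem_image.2 ⟨(s, t), Finset.mem_product.2 ⟨hs, ht⟩, rfl⟩))] with y h1 h2
    simpa only [h1] using h2
  filter_upwards [(Finset.eventually_all T).2 hle] with y hy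
  have hsum : ∑ s ∈ T, ∑ g ∈ H with s⁻¹ * g ∈ C, d T (g • y) = ∑ g ∈ H, d T (g • y) := by
    simp_rw [Finset.sum_filter]
    rw [Finset.sum_comm]
    refine Finset.sum_congr rfl fun g _ => ?_
    obtain ⟨c, ⟨hc, s, hs, hgs⟩, huniq⟩ := hC g
    rw [Finset.sum_eq_single_of_mem s hs, if_pos (by simpa [hgs] using hc)]
    intro u hu hus
    refine if_neg fun hmem => hus ?_
    have := huniq _ ⟨hmem, u, hu, (mul_inv_cancel_left u g).symm⟩
    rw [← this] at hgs
    have h2 : u * (u⁻¹ * g) = s * (u⁻¹ * g) := by rw [← hgs, mul_inv_cancel_left]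
    exact mul_right_cancel h2
  have hpos : (0 : ℝ) < T.card := by exact_mod_cast hTne.card_pos
  rw [le_inv_mul_iff₀ hpos, ← hsum, ← nsmul_eq_mul]
  exact Finset.card_nsmul_le_sum T _ _ hy
end

section
/- Let (Y, 𝒟, ν) be a probability space and let 𝐃 = {d_F : F ∈ 𝓕_G} ⊆ L¹(Y, 𝒟, ν) be a strongly sub-additive family. Suppose 1_E = Σ_{i=1}^n a_i 1_{E_i}, where E, E_1, …, E_n ∈ 𝓕_G and a_1, …, a_n > 0 are real numbers. Then d_E(y) ≤ Σ_{i=1}^n a_i d_{E_i}(y) for ν-a.e. y ∈ Y. -/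
open MeasureTheory

/-- A submodular set function has, on every finite set `E`, a modular minorant agreeing with it
on `E`. -/
theorem exists_sum_eq_and_sum_le_of_submodular {α : Type*} [DecidableEq α] {f : Finset α → ℝ}
    (hf0 : f ∅ = 0) (hf : ∀ E F, f (E ∩ F) + f (E ∪ F) ≤ f E + f F) (E : Finset α) :
    ∃ w : α → ℝ, ∑ x ∈ E, w x = f E ∧ ∀ F ⊆ E, ∑ x ∈ F, w x ≤ f F := by
  induction E using Finset.induction_on with
  | empty =>
    refine ⟨0, by simp [hf0], fun F hF => ?_⟩
    simp [Finset.subset_empty.mp hF, hf0]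
  | insert x E hx ih =>
    obtain ⟨w, hwE, hw⟩ := ih
    have hsum (F : Finset α) (hF : x ∉ F) (c : ℝ) :
        ∑ z ∈ F, Function.update w x c z = ∑ z ∈ F, w z :=
      Finset.sum_update_of_notMem hF w c
    refine ⟨Function.update w x (f (insert x E) - f E), ?_, fun F hF => ?_⟩
    · rw [Finset.sum_insert hx, hsum E hx, hwE, Function.update_self]
      ring
    · by_cases hxF : x ∈ F
      · have hinter : F ∩ E = F.erase x := by
          ext z
          have := @hF z
          grind
        have hunion : F ∪ E = insert x E := by
          ext z
          have := @hF z
          grind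
        have h := hf F E
        rw [hinter, hunion] at h
        have hle := hw (F.erase x) (hinter ▸ Finset.inter_subset_right)
        rw [← Finset.add_sum_erase F _ hxF, hsum _ (Finset.notMem_erase x F),
          Function.update_self]
        linarith
      · rw [hsum F hxF]
        exact hw F ((Finset.subset_insert_iff_of_notMem hxF).mp hF)

/-- A submodular set function is sub-additive along decompositions of an indicator function into
non-negative combinations of indicator functions of subsets. -/
theorem le_sum_mul_of_submodular {α ι : Type*} [DecidableEq α] [Fintype ι] {f : Finset α → ℝ}
    (hf0 : f ∅ = 0) (hf : ∀ E F, f (E ∩ F) + f (E ∪ F) ≤ f E + f F)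
    {a : ι → ℝ} (ha : ∀ i, 0 ≤ a i) {A : ι → Finset α} {E : Finset α} (hA : ∀ i, A i ⊆ E)
    (hE : ∀ x ∈ E, ∑ i, a i * (if x ∈ A i then (1 : ℝ) else 0) = 1) :
    f E ≤ ∑ i, a i * f (A i) := by
  obtain ⟨w, hwE, hw⟩ := exists_sum_eq_and_sum_le_of_submodular hf0 hf E
  calc f E = ∑ x ∈ E, (∑ i, a i * (if x ∈ A i then (1 : ℝ) else 0)) * w x := by
        rw [← hwE]
        exact Finset.sum_congr rfl fun x hx => by rw [hE x hx, one_mul]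
    _ = ∑ i, a i * ∑ x ∈ E, (if x ∈ A i then w x else 0) := by
        simp_rw [Finset.sum_mul, Finset.mul_sum]
        rw [Finset.sum_comm]
        simp
    _ = ∑ i, a i * ∑ x ∈ A i, w x := by
        simp_rw [Finset.sum_ite_mem, Finset.inter_eq_right.mpr (hA _)]
    _ ≤ ∑ i, a i * f (A i) :=
        Finset.sum_le_sum fun i _ => mul_le_mul_of_nonneg_left (hw _ (hA i)) (ha i)

/-- Lemma 4.6 of the paper: let `𝐃 = {d_F} ⊆ L¹(ν)` be a strongly sub-additive family (with
the convention `d_∅ = 0`). If `1_E = Σ_{i} a_i 1_{E_i}` with `E, E_1, …, E_n` non-empty finite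
subsets of `G` and `a_i > 0`, then `d_E(y) ≤ Σ_i a_i d_{E_i}(y)` for `ν`-a.e. `y`. -/
theorem strongly_subadditive_indicator_decomposition
    {G : Type*} [Group G] [Countable G] [DecidableEq G]
    {Y : Type*} [MeasurableSpace Y]
    (ν : Measure Y) [IsProbabilityMeasure ν]
    (d : Finset G → Y → ℝ)
    (hint : ∀ F : Finset G, F.Nonempty → Integrable (d F) ν)
    (hd0 : ∀ y, d ∅ y = 0)
    (hstrong : ∀ E F : Finset G,
      ∀ᵐ y ∂ν, d (E ∩ F) y + d (E ∪ F) y ≤ d E y + d F y)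
    (n : ℕ) (a : Fin n → ℝ) (ha : ∀ i, 0 < a i)
    (Efam : Fin n → Finset G) (hEfam : ∀ i, (Efam i).Nonempty)
    (E : Finset G) (hE : E.Nonempty)
    (hdecomp : ∀ x : G,
      (if x ∈ E then (1 : ℝ) else 0) = ∑ i, a i * (if x ∈ Efam i then (1 : ℝ) else 0)) :
    ∀ᵐ y ∂ν, d E y ≤ ∑ i, a i * d (Efam i) y := by
  have hsub (i : Fin n) : Efam i ⊆ E := by
    intro x hx
    by_contra hxE
    have hpos : 0 < ∑ j, a j * (if x ∈ Efam j then (1 : ℝ) else 0) :=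
      Finset.sum_pos' (fun j _ => mul_nonneg (ha j).le (by split_ifs <;> norm_num))
        ⟨i, Finset.mem_univ i, by simpa [hx] using ha i⟩
    rw [← hdecomp x, if_neg hxE] at hpos
    exact hpos.false
  have hall : ∀ᵐ y ∂ν, ∀ A B : Finset G, d (A ∩ B) y + d (A ∪ B) y ≤ d A y + d B y :=
    ae_all_iff.mpr fun A => ae_all_iff.mpr fun B => hstrong A B
  filter_upwards [hall] with y hy
  exact le_sum_mul_of_submodular (f := fun F => d F y) (hd0 y) hy (fun i => (ha i).le) hsub
    fun x hx => by rw [← hdecomp x, if_pos hx]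
end

section
/- Let θ be an invertible measure-preserving transformation of a standard probability space (Y, 𝒟, ν), inducing a ℤ-action, and let 𝐃 = {d_F : F ∈ 𝓕_ℤ} ⊆ L¹(Y, 𝒟, ν) be a non-negative sup-additive ℤ-invariant family. Then for every α > 0, ν({y ∈ Y : sup_{n ∈ ℕ} (1/n) d_{{0,1,…,n−1}}(y) > α}) ≤ ν(𝐃)/α. -/
open MeasureTheory Filter Topology
open scoped ENNReal

/-- A non-empty finite subset `T` of `ℤ` tiles `ℤ` if some family of translates
`{T + c : c ∈ C}` forms a partition of `ℤ`. -/
def ZTiles (T : Finset ℤ) : Prop :=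
  T.Nonempty ∧ ∃ C : Set ℤ, ∀ x : ℤ, ∃! c : ℤ, c ∈ C ∧ ∃ t ∈ T, x = t + c

/-- Greedy covering: if `g a b` is a non-negative superadditive function of intervals, and every
point `k` of `I` starts an interval of length `n ≤ N` with `g k (k + n) ≥ α n`, then
`g a (a + L + N)` is at least `α` times the number of points of `I` in `[a, a + L)`. -/
theorem mul_card_filter_Ico_le_of_superadditive (g : ℕ → ℕ → ℝ) (hg : ∀ a b, 0 ≤ g a b)
    (hadd : ∀ a b c, a ≤ b → b ≤ c → g a b + g b c ≤ g a c)
    {α : ℝ} (hα : 0 ≤ α) (N : ℕ) (I : ℕ → Prop) [DecidablePred I]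
    (hI : ∀ k, I k → ∃ n, 1 ≤ n ∧ n ≤ N ∧ α * n ≤ g k (k + n)) (L a : ℕ) :
    α * ((Finset.Ico a (a + L)).filter I).card ≤ g a (a + L + N) := by
  induction L using Nat.strong_induction_on generalizing a with
  | _ L ih =>
    rcases Nat.eq_zero_or_pos L with rfl | hL
    · simpa using hg _ _
    by_cases ha : I a
    · obtain ⟨n, hn1, hnN, hn⟩ := hI a ha
      by_cases hnL : n ≤ L
      · have h1 := ih (L - n) (by omega) (a + n)
        rw [show a + n + (L - n) = a + L by omega] at h1
        have h2 := hadd a (a + n) (a + L + N) (by omega) (by omega)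
        have h3 : ((Finset.Ico a (a + L)).filter I).card
            ≤ n + ((Finset.Ico (a + n) (a + L)).filter I).card := by
          rw [← Finset.Ico_union_Ico_eq_Ico (show a ≤ a + n by omega)
            (show a + n ≤ a + L by omega), Finset.filter_union]
          refine (Finset.card_union_le _ _).trans (Nat.add_le_add_right ?_ _)
          exact (Finset.card_filter_le _ _).trans (by simp)
        have h4 : (((Finset.Ico a (a + L)).filter I).card : ℝ)
            ≤ n + ((Finset.Ico (a + n) (a + L)).filter I).card := by exact_mod_cast h3
        have h5 := mul_le_mul_of_nonneg_left h4 hα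
        rw [mul_add] at h5
        linarith
      · have h2 := hadd a (a + n) (a + L + N) (by omega) (by omega)
        have h3 : ((Finset.Ico a (a + L)).filter I).card ≤ n :=
          (Finset.card_filter_le _ _).trans (by simp; omega)
        have h4 : (((Finset.Ico a (a + L)).filter I).card : ℝ) ≤ n := by exact_mod_cast h3
        have h5 := mul_le_mul_of_nonneg_left h4 hα
        linarith [hg (a + n) (a + L + N)]
    · have h1 := ih (L - 1) (by omega) (a + 1)
      rw [show a + 1 + (L - 1) = a + L by omega] at h1
      have h2 := hadd a (a + 1) (a + L + N) (by omega) (by omega)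
      have h3 : (Finset.Ico a (a + L)).filter I = (Finset.Ico (a + 1) (a + L)).filter I := by
        ext k
        simp only [Finset.mem_filter, Finset.mem_Ico]
        refine ⟨fun ⟨h, hk⟩ => ⟨⟨?_, h.2⟩, hk⟩, fun ⟨h, hk⟩ => ⟨⟨by omega, h.2⟩, hk⟩⟩
        rcases Nat.lt_or_eq_of_le h.1 with h' | rfl
        · exact h'
        · exact absurd hk ha
      rw [h3]
      linarith [hg a (a + 1)]

theorem zTiles_Ico {m : ℕ} (hm : 0 < m) : ZTiles (Finset.Ico (0 : ℤ) m) := by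
  have hm' : (0 : ℤ) < m := by exact_mod_cast hm
  refine ⟨⟨0, by simpa using hm⟩, {c | (m : ℤ) ∣ c}, fun x => ⟨m * (x / m), ?_, ?_⟩⟩
  · refine ⟨dvd_mul_right _ _, x % m, ?_, (Int.emod_add_mul_ediv x m).symm⟩
    simp [Int.emod_nonneg x hm'.ne', Int.emod_lt_of_pos x hm']
  · rintro c ⟨⟨e, rfl⟩, t, ht, rfl⟩
    rw [Finset.mem_Ico] at ht
    rw [Int.add_mul_ediv_left _ _ hm'.ne', Int.ediv_eq_zero_of_lt ht.1 ht.2, zero_add]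

theorem image_ofNat_range (n : ℕ) :
    (Finset.range n).image Int.ofNat = Finset.Ico (0 : ℤ) n := by
  ext x
  simp only [Finset.mem_image, Finset.mem_range, Finset.mem_Ico]
  constructor
  · rintro ⟨a, ha, rfl⟩
    simpa using ha
  · rintro ⟨h0, h1⟩
    exact ⟨x.toNat, by omega, by simp [h0]⟩

theorem measurePreserving_perm_zpow {Y : Type*} [MeasurableSpace Y] {ν : Measure Y}
    {θ : Equiv.Perm Y} (hθ : MeasurePreserving θ ν ν) (k : ℕ) :
    MeasurePreserving (⇑(θ ^ (k : ℤ))) ν ν := by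
  rw [zpow_natCast, ← Equiv.Perm.iterate_eq_pow]
  exact hθ.iterate k

/-- Averaged form of the maximal inequality, for orbit segments of length `L` and excursions of
length at most `N`. -/
theorem mul_measureReal_le_integral_Ico {Y : Type*} [MeasurableSpace Y]
    (ν : Measure Y) [IsProbabilityMeasure ν]
    (θ : Equiv.Perm Y) (hθ : MeasurePreserving θ ν ν)
    (d : Finset ℤ → Y → ℝ)
    (hint : ∀ F : Finset ℤ, F.Nonempty → Integrable (d F) ν)
    (hinv : ∀ F : Finset ℤ, F.Nonempty → ∀ k : ℤ,
      ∀ᵐ y ∂ν, d (F.image (· + k)) y = d F ((θ ^ k) y))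
    (hnonneg : ∀ F : Finset ℤ, F.Nonempty → ∀ᵐ y ∂ν, 0 ≤ d F y)
    (hsup : ∀ E F : Finset ℤ, E.Nonempty → F.Nonempty → Disjoint E F →
      ∀ᵐ y ∂ν, d E y + d F y ≤ d (E ∪ F) y)
    {α : ℝ} (hα : 0 < α) (N : ℕ) {L : ℕ} (hL : 0 < L) :
    α * (L * ν.real {y | ∃ n < N, α < d (Finset.Ico (0 : ℤ) ((n + 1 : ℕ) : ℤ)) y / ((n : ℝ) + 1)})
      ≤ ∫ y, d (Finset.Ico (0 : ℤ) ((L + N : ℕ) : ℤ)) y ∂ν := by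
  classical
  set E : Set Y :=
    {y | ∃ n < N, α < d (Finset.Ico (0 : ℤ) ((n + 1 : ℕ) : ℤ)) y / ((n : ℝ) + 1)} with hE
  have hne : ∀ a b : ℕ, a < b → (Finset.Ico (a : ℤ) b).Nonempty := fun a b h => by
    simpa using h
  have hne0 : ∀ b : ℕ, 0 < b → (Finset.Ico (0 : ℤ) b).Nonempty := fun b h => by
    simpa using h
  have hEmeas : NullMeasurableSet E ν := by
    have : E = ⋃ n : ℕ, ⋃ _ : n < N,
        {y | α < d (Finset.Ico (0 : ℤ) ((n + 1 : ℕ) : ℤ)) y / ((n : ℝ) + 1)} := by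
      ext y
      simp [hE]
    rw [this]
    refine NullMeasurableSet.iUnion fun n => NullMeasurableSet.iUnion fun _ => ?_
    exact nullMeasurableSet_lt aemeasurable_const
      ((hint _ (hne0 _ n.succ_pos)).aemeasurable.div_const _)
  have hpre : ∀ k : ℕ, NullMeasurableSet ((⇑(θ ^ (k : ℤ))) ⁻¹' E) ν := fun k =>
    hEmeas.preimage (measurePreserving_perm_zpow hθ k).quasiMeasurePreserving
  have hintk : ∀ k : ℕ, Integrable (((⇑(θ ^ (k : ℤ))) ⁻¹' E).indicator (fun _ => (1 : ℝ))) ν :=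
    fun k => (integrable_const 1).indicator₀ (hpre k)
  have hcount : ∫ y, α * ∑ k ∈ Finset.Ico 0 (0 + L),
      ((⇑(θ ^ (k : ℤ))) ⁻¹' E).indicator (fun _ => (1 : ℝ)) y ∂ν = α * (L * ν.real E) := by
    rw [integral_const_mul, integral_finsetSum _ fun k _ => hintk k]
    congr 1
    have : ∀ k : ℕ,
        ∫ y, ((⇑(θ ^ (k : ℤ))) ⁻¹' E).indicator (fun _ => (1 : ℝ)) y ∂ν = ν.real E := fun k => by
      rw [integral_indicator₀ (hpre k)]
      rw [setIntegral_const, smul_eq_mul, mul_one, measureReal_def, measureReal_def,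
        (measurePreserving_perm_zpow hθ k).measure_preimage hEmeas]
    simp only [this, Finset.sum_const, nsmul_eq_mul, zero_add, Nat.card_Ico, Nat.sub_zero]
  rw [← hcount]
  have hLN : 0 < L + N := by omega
  refine integral_mono_ae ((integrable_finsetSum _ fun k _ => hintk k).const_mul α)
    (hint _ (hne0 _ hLN)) ?_
  have H1 : ∀ᵐ y ∂ν, ∀ a b : ℕ, a < b → 0 ≤ d (Finset.Ico (a : ℤ) b) y := by
    simp only [ae_all_iff]
    exact fun a b h => hnonneg _ (hne a b h)
  have H2 : ∀ᵐ y ∂ν, ∀ a b c : ℕ, a < b → b < c →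
      d (Finset.Ico (a : ℤ) b) y + d (Finset.Ico (b : ℤ) c) y ≤ d (Finset.Ico (a : ℤ) c) y := by
    simp only [ae_all_iff]
    intro a b c hab hbc
    have := hsup _ _ (hne a b hab) (hne b c hbc)
      (Finset.Ico_disjoint_Ico_consecutive (a : ℤ) b c)
    rwa [Finset.Ico_union_Ico_eq_Ico (by exact_mod_cast hab.le) (by exact_mod_cast hbc.le)] at this
  have H3 : ∀ᵐ y ∂ν, ∀ k n : ℕ, 0 < n →
      d (Finset.Ico (k : ℤ) ((k + n : ℕ) : ℤ)) y
        = d (Finset.Ico (0 : ℤ) n) ((θ ^ (k : ℤ)) y) := by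
    simp only [ae_all_iff]
    intro k n hn
    have := hinv _ (hne0 n hn) k
    rw [Finset.image_add_right_Ico] at this
    rwa [zero_add, add_comm (n : ℤ), ← Nat.cast_add] at this
  filter_upwards [H1, H2, H3] with y h1 h2 h3
  have key := mul_card_filter_Ico_le_of_superadditive
    (fun a b => if a < b then d (Finset.Ico (a : ℤ) b) y else 0)
    (fun a b => by
      split_ifs with h
      exacts [h1 a b h, le_rfl])
    (fun a b c hab hbc => by
      rcases hab.eq_or_lt with rfl | hab
      · simp
      rcases hbc.eq_or_lt with rfl | hbc
      · simp
      simpa [hab, hbc, hab.trans hbc] using h2 a b c hab hbc)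
    hα.le N (fun k => (θ ^ (k : ℤ)) y ∈ E)
    (fun k ⟨n, hn, hlt⟩ => ⟨n + 1, by omega, hn, by
      rw [lt_div_iff₀ (by positivity)] at hlt
      rw [if_pos (by omega), h3 k (n + 1) n.succ_pos]
      push_cast at hlt ⊢
      exact hlt.le⟩) L 0
  rw [if_pos (by omega)] at key
  simp only [zero_add, Nat.cast_zero] at key
  refine le_trans (le_of_eq ?_) key
  congr 1
  rw [Finset.card_filter]
  simp [Set.indicator_apply]

/-- Proposition 6.3 of the paper (a version of the maximal ergodic inequality): let `θ` be an
invertible measure-preserving transformation of a probability space `(Y, 𝒟, ν)` (inducing a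
`ℤ`-action `k · y = θ^k y`) and let `𝐃 = {d_F : F ∈ 𝓕_ℤ} ⊆ L¹(ν)` be a non-negative
sup-additive `ℤ`-invariant family. Then for every `α > 0`,
`ν({y : sup_n (1/n) d_{{0,…,n-1}}(y) > α}) ≤ ν(𝐃)/α`, where
`ν(𝐃) = sup_{T ∈ 𝒯_ℤ} (1/|T|) ∫ d_T dν`. -/
theorem maximal_inequality_Z
    {Y : Type*} [MeasurableSpace Y]
    (ν : Measure Y) [IsProbabilityMeasure ν]
    (θ : Equiv.Perm Y) (hθ : MeasurePreserving θ ν ν)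
    (hθ' : MeasurePreserving θ.symm ν ν)
    (d : Finset ℤ → Y → ℝ)
    (hint : ∀ F : Finset ℤ, F.Nonempty → Integrable (d F) ν)
    (hinv : ∀ F : Finset ℤ, F.Nonempty → ∀ k : ℤ,
      ∀ᵐ y ∂ν, d (F.image (· + k)) y = d F ((θ ^ k) y))
    (hnonneg : ∀ F : Finset ℤ, F.Nonempty → ∀ᵐ y ∂ν, 0 ≤ d F y)
    (hsup : ∀ E F : Finset ℤ, E.Nonempty → F.Nonempty → Disjoint E F →
      ∀ᵐ y ∂ν, d E y + d F y ≤ d (E ∪ F) y)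
    (α : ℝ) (hα : 0 < α) :
    (ν {y : Y | (α : EReal) < ⨆ n : ℕ,
        ((d ((Finset.range (n + 1)).image Int.ofNat) y / ((n : ℝ) + 1) : ℝ) : EReal)} : EReal)
      ≤ ((α⁻¹ : ℝ) : EReal)
        * ⨆ T ∈ {T : Finset ℤ | ZTiles T},
            (((T.card : ℝ)⁻¹ * ∫ y, d T y ∂ν : ℝ) : EReal) := by
  classical
  simp only [image_ofNat_range]
  set S : EReal := ⨆ T ∈ {T : Finset ℤ | ZTiles T},
    (((T.card : ℝ)⁻¹ * ∫ y, d T y ∂ν : ℝ) : EReal) with hS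
  have hle : ∀ m : ℕ, 0 < m →
      (((m : ℝ)⁻¹ * ∫ y, d (Finset.Ico (0 : ℤ) m) y ∂ν : ℝ) : EReal) ≤ S := fun m hm => by
    have := le_iSup₂_of_le (f := fun (T : Finset ℤ) (_ : T ∈ {T : Finset ℤ | ZTiles T}) =>
      (((T.card : ℝ)⁻¹ * ∫ y, d T y ∂ν : ℝ) : EReal)) _ (zTiles_Ico hm) le_rfl
    rwa [Int.card_Ico, sub_zero, Int.toNat_natCast] at this
  rcases eq_or_ne S ⊤ with hT | hT
  · rw [hT, EReal.coe_mul_top_of_pos (inv_pos.2 hα)]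
    exact le_top
  have hB : S ≠ ⊥ := fun h => by simpa [h] using hle 1 one_pos
  lift S to ℝ using ⟨hT, hB⟩ with s
  set E : ℕ → Set Y := fun N =>
    {y | ∃ n < N, α < d (Finset.Ico (0 : ℤ) ((n + 1 : ℕ) : ℤ)) y / ((n : ℝ) + 1)} with hE
  have hbound : ∀ N, ν.real (E N) ≤ α⁻¹ * s := fun N => by
    have hev : ∀ᶠ L : ℕ in atTop,
        ((L : ℝ) / (L + N)) * (α * ν.real (E N)) ≤ s := by
      filter_upwards [eventually_gt_atTop 0] with L hL
      have h1 := mul_measureReal_le_integral_Ico ν θ hθ d hint hinv hnonneg hsup hα N hL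
      have h2 := EReal.coe_le_coe_iff.1 (hle (L + N) (by omega))
      have hpos : (0 : ℝ) < ((L + N : ℕ) : ℝ) := by exact_mod_cast (by omega : 0 < L + N)
      rw [inv_mul_le_iff₀ hpos] at h2
      rw [← Nat.cast_add, div_mul_eq_mul_div, div_le_iff₀ hpos]
      calc (L : ℝ) * (α * ν.real (E N)) = α * (L * ν.real (E N)) := by ring
        _ ≤ _ := h1.trans h2
        _ = _ := mul_comm _ _
    have hlim : Tendsto (fun L : ℕ => ((L : ℝ) / (L + N)) * (α * ν.real (E N))) atTop
        (𝓝 (1 * (α * ν.real (E N)))) :=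
      (tendsto_natCast_div_add_atTop (N : ℝ)).mul_const _
    have := le_of_tendsto hlim hev
    rwa [one_mul, ← le_inv_mul_iff₀ hα] at this
  have hset : {y : Y | (α : EReal) < ⨆ n : ℕ,
      ((d (Finset.Ico (0 : ℤ) ((n + 1 : ℕ) : ℤ)) y / ((n : ℝ) + 1) : ℝ) : EReal)}
      = ⋃ N, E N := by
    ext y
    simp only [Set.mem_ofPred_eq, lt_iSup_iff, EReal.coe_lt_coe_iff, Set.mem_iUnion, hE]
    exact ⟨fun ⟨n, hn⟩ => ⟨n + 1, n, n.lt_succ_self, hn⟩, fun ⟨_, n, _, hn⟩ => ⟨n, hn⟩⟩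
  have hmono : Monotone E := fun M N hMN y ⟨n, hn, h⟩ => ⟨n, hn.trans_le hMN, h⟩
  have hnn : 0 ≤ α⁻¹ * s := measureReal_nonneg.trans (hbound 0)
  have hfin : ν (⋃ N, E N) ≤ ENNReal.ofReal (α⁻¹ * s) := by
    rw [hmono.measure_iUnion]
    refine iSup_le fun N => ?_
    rw [← ofReal_measureReal]
    exact ENNReal.ofReal_le_ofReal (hbound N)
  rw [hset, ← EReal.coe_mul]
  refine (EReal.coe_ennreal_le_coe_ennreal_iff.2 hfin).trans ?_
  rw [EReal.coe_ennreal_ofReal, max_eq_left hnn]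
end
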